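/- arXiv:dg-ga/9707001 — 3 statements merged into one kernel-verified Lean document; each statement's English description precedes it below -/
import Mathlib

section
/- Let Γ : ℝᵐ × ℝᴺ → ℝ^{N×m} be a smooth map with components Γᴬ_μ(x,y) (A = 1,…,N; μ = 1,…,m). The following are equivalent: (i) for every (x₀, y₀) ∈ ℝᵐ × ℝᴺ there exist an open neighborhood U of x₀ and a C¹ map f : U → ℝᴺ with f(x₀) = y₀ and ∂fᴬ/∂xᵘ(x) = Γᴬ_μ(x, f(x)) for all x ∈ U and all A, μ; (ii) for every (x,y) ∈ ℝᵐ × ℝᴺ and all A, μ, ν: ∂Γᴬ_ν/∂xᵘ + Σ_B Γᴮ_μ ∂Γᴬ_ν/∂yᴮ − ∂Γᴬ_μ/∂x^ν − Σ_B Γᴮ_ν ∂Γᴬ_μ/∂yᴮ = 0 at (x,y). -/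
open Set Metric Filter Topology in
/-- Picard-Lindelöf, keeping track of the ball containing the solution. -/
theorem picard_mem {E : Type*} [NormedAddCommGroup E] [NormedSpace ℝ E] [CompleteSpace E]
    {f : ℝ → E → E} {tmin tmax : ℝ} {t₀ : Icc tmin tmax} {x₀ : E} {a L K : NNReal}
    (hf : IsPicardLindelof f t₀ x₀ a 0 L K) :
    ∃ α : ℝ → E, α t₀ = x₀ ∧ ∀ t ∈ Icc tmin tmax, α t ∈ closedBall x₀ a ∧
      HasDerivWithinAt α (f t (α t)) (Icc tmin tmax) t := by
  have hx : x₀ ∈ closedBall x₀ ((0 : NNReal) : ℝ) := mem_closedBall_self le_rfl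
  obtain ⟨α, hα⟩ := ODE.FunSpace.exists_isFixedPt_next hf hx
  refine ⟨α.compProj, by rw [ODE.FunSpace.compProj_val, ← hα, ODE.FunSpace.next_apply₀],
    fun t ht ↦ ⟨α.compProj_mem_closedBall hf.mul_max_le, ?_⟩⟩
  apply ODE.hasDerivWithinAt_picard_Icc t₀.2 hf.continuousOn_uncurry
    α.continuous_compProj.continuousOn (fun _ ht' ↦ α.compProj_mem_closedBall hf.mul_max_le)
    x₀ ht |>.congr_of_mem _ ht
  intro t' ht'
  nth_rw 1 [← hα]
  rw [ODE.FunSpace.compProj_of_mem ht', ODE.FunSpace.next_apply]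

open Set Metric Filter Topology in
/-- Uniform constants near a point for a `C²` map. -/
theorem local_consts {V W : Type*} [NormedAddCommGroup V] [NormedSpace ℝ V]
    [NormedAddCommGroup W] [NormedSpace ℝ W] (G : V → W) (hG : ContDiff ℝ 2 G) (p₀ : V) :
    ∃ ε > (0 : ℝ), ∃ M : NNReal, 1 ≤ M ∧
      (∀ p ∈ closedBall p₀ ε, ‖G p‖ ≤ M) ∧ (∀ p ∈ closedBall p₀ ε, ‖fderiv ℝ G p‖ ≤ M) ∧
      LipschitzOnWith M G (closedBall p₀ ε) ∧
      (∀ p ∈ closedBall p₀ ε, ∀ q ∈ closedBall p₀ ε,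
        ‖G q - G p - fderiv ℝ G p (q - p)‖ ≤ M * ‖q - p‖ ^ 2) := by
  have hD : ContDiff ℝ 1 (fderiv ℝ G) := hG.fderiv_right (by norm_num)
  obtain ⟨K, s, hs, hK⟩ := hD.contDiffAt.exists_lipschitzOnWith (x := p₀)
  have h1 : ∀ᶠ p in 𝓝 p₀, ‖G p‖ < ‖G p₀‖ + 1 :=
    hG.continuous.norm.continuousAt.eventually_lt continuousAt_const (by simp)
  have h2 : ∀ᶠ p in 𝓝 p₀, ‖fderiv ℝ G p‖ < ‖fderiv ℝ G p₀‖ + 1 :=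
    hD.continuous.norm.continuousAt.eventually_lt continuousAt_const (by simp)
  obtain ⟨ε, hε, hb⟩ := nhds_basis_closedBall.mem_iff.1 (inter_mem hs (h1.and h2))
  let M : NNReal := 1 + K + ‖G p₀‖₊ + ‖fderiv ℝ G p₀‖₊
  have hM : (M : ℝ) = 1 + K + ‖G p₀‖ + ‖fderiv ℝ G p₀‖ := by simp [M]
  have n1 := norm_nonneg (G p₀)
  have n2 := norm_nonneg (fderiv ℝ G p₀)
  have n3 := K.2
  have hbd : ∀ p ∈ closedBall p₀ ε, ‖fderiv ℝ G p‖ ≤ M := fun p hp => by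
    have := (hb hp).2.2
    rw [hM]; linarith [K.coe_nonneg]
  have hdiff : Differentiable ℝ G := hG.differentiable (by norm_num)
  refine ⟨ε, hε, M, ?_, ?_, hbd, ?_, ?_⟩
  · rw [← NNReal.coe_le_coe, hM]; push_cast; linarith [K.coe_nonneg]
  · intro p hp
    have := (hb hp).2.1
    rw [hM]; linarith [K.coe_nonneg]
  · exact (convex_closedBall p₀ ε).lipschitzOnWith_of_nnnorm_fderiv_le
      (fun x _ => hdiff x) (fun x hx => by exact_mod_cast hbd x hx)
  · intro p hp q hq
    have hseg : segment ℝ p q ⊆ closedBall p₀ ε := (convex_closedBall p₀ ε).segment_subset hp hq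
    have := (convex_segment p q).norm_image_sub_le_of_norm_fderiv_le' (𝕜 := ℝ) (f := G)
      (φ := fderiv ℝ G p) (C := M * ‖q - p‖) (fun x _ => hdiff x) ?_
      (left_mem_segment ℝ p q) (right_mem_segment ℝ p q)
    · calc _ ≤ _ := this
        _ = _ := by ring
    · intro x hx
      have h := hK.norm_sub_le (hb (hseg hx)).1 (hb hp).1
      refine h.trans ?_
      have hKM : (K : ℝ) ≤ M := by rw [hM]; linarith
      have : ‖x - p‖ ≤ ‖q - p‖ := by
        simpa using norm_sub_le_of_mem_segment hx
      gcongr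

open Set Metric Filter Topology in
theorem frobenius_exists {E F : Type*} [NormedAddCommGroup E] [NormedSpace ℝ E]
    [NormedAddCommGroup F] [NormedSpace ℝ F] [CompleteSpace F]
    (G : E × F → E →L[ℝ] F) (hG : ContDiff ℝ 2 G)
    (flat : ∀ p a b, fderiv ℝ G p (a, G p a) b = fderiv ℝ G p (b, G p b) a)
    (x₀ : E) (y₀ : F) :
    ∃ δ > (0 : ℝ), ∃ f : E → F, f x₀ = y₀ ∧
      ∀ x ∈ ball x₀ δ, HasFDerivAt f (G (x, f x)) x := by
  obtain ⟨ε, hε, M, hM1, hGM, hDM, hLip, hTay⟩ := local_consts G hG (x₀, y₀)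
  have hM1' : (1 : ℝ) ≤ M := by exact_mod_cast hM1
  have hM0 : (0 : ℝ) < M := by linarith
  have hdiff : Differentiable ℝ G := hG.differentiable (by norm_num)
  obtain ⟨δ, hδ, hδ1, hδε⟩ : ∃ δ : ℝ, 0 < δ ∧ δ ≤ 1 ∧ M * δ ≤ ε / 2 := by
    refine ⟨min 1 (ε / 2 / M), by positivity, min_le_left _ _, ?_⟩
    calc M * min 1 (ε / 2 / M) ≤ M * (ε / 2 / M) := by gcongr; exact min_le_right _ _
      _ = ε / 2 := by field_simp
  have hδε' : δ ≤ ε := by nlinarith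
  -- membership in the good ball
  have hmem : ∀ v : E, ‖v‖ ≤ δ → ∀ t ∈ Icc (0 : ℝ) 1, ∀ y ∈ closedBall y₀ ε,
      (x₀ + t • v, y) ∈ closedBall (x₀, y₀) ε := by
    intro v hv t ht y hy
    rw [mem_closedBall, Prod.dist_eq]
    refine max_le ?_ hy
    have : ‖t • v‖ ≤ 1 * ‖v‖ := by
      rw [norm_smul, Real.norm_of_nonneg ht.1]; gcongr; exact ht.2
    simp only [dist_self_add_left]
    linarith
  -- the vector fields
  have hvlip : ∀ v : E, ‖v‖ ≤ δ → ∀ t ∈ Icc (0 : ℝ) 1,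
      LipschitzOnWith M (fun y => G (x₀ + t • v, y) v) (closedBall y₀ ε) := by
    intro v hv t ht
    refine LipschitzOnWith.of_dist_le_mul fun y hy z hz => ?_
    rw [dist_eq_norm, ← _root_.sub_apply]
    refine (ContinuousLinearMap.le_opNorm _ _).trans ?_
    have h := hLip.norm_sub_le (hmem v hv t ht y hy) (hmem v hv t ht z hz)
    have e : ‖((x₀ + t • v, y) : E × F) - (x₀ + t • v, z)‖ = dist y z := by
      simp [dist_eq_norm, Prod.norm_def]
    rw [e] at h
    calc _ ≤ (M * dist y z) * 1 := by gcongr; linarith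
      _ = _ := by ring
  have hsol : ∀ v : E, ∃ α : ℝ → F, ‖v‖ ≤ δ → α 0 = y₀ ∧ ∀ t ∈ Icc (0 : ℝ) 1,
      α t ∈ closedBall y₀ (ε / 2) ∧
      HasDerivWithinAt α (G (x₀ + t • v, α t) v) (Icc 0 1) t := by
    intro v
    by_cases hv : ‖v‖ ≤ δ
    swap
    · exact ⟨fun _ => 0, fun h => absurd h hv⟩
    have hsub : closedBall y₀ (ε / 2) ⊆ closedBall y₀ ε := closedBall_subset_closedBall (by linarith)
    have hP : IsPicardLindelof (fun t y => G (x₀ + t • v, y) v) (tmin := 0) (tmax := 1)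
        ⟨0, by simp⟩ y₀ (ε / 2).toNNReal 0 (M * δ.toNNReal) M := by
      have ce : ((ε / 2).toNNReal : ℝ) = ε / 2 := Real.coe_toNNReal _ (by positivity)
      have cd : (δ.toNNReal : ℝ) = δ := Real.coe_toNNReal _ hδ.le
      rw [← ce] at hsub
      refine ⟨fun t ht => (hvlip v hv t ht).mono hsub, fun y hy => ?_, fun t ht y hy => ?_, ?_⟩
      · have := hG.continuous
        fun_prop
      · refine (ContinuousLinearMap.le_opNorm _ _).trans ?_
        have := hGM _ (hmem v hv t ht y (hsub hy))
        calc _ ≤ (M : ℝ) * δ := by gcongr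
          _ = _ := by rw [NNReal.coe_mul, cd]
      · rw [NNReal.coe_mul, cd, ce]; simpa using hδε
    obtain ⟨α, h0, h⟩ := picard_mem hP
    rw [Real.coe_toNNReal _ (by positivity)] at h
    exact ⟨α, fun _ => ⟨h0, h⟩⟩
  choose α hα using hsol
  refine ⟨δ, hδ, fun x => α (x - x₀) 1, ?_, ?_⟩
  · -- the value at the base point
    obtain ⟨h0, h⟩ := hα (x₀ - x₀) (by simp [hδ.le])
    have := norm_image_sub_le_of_norm_deriv_le_segment_01' (C := 0) (fun t ht => (h t ht).2)
      (by simp)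
    rw [h0] at this
    simpa [sub_eq_zero] using this
  · intro x hx
    obtain ⟨v, rfl⟩ : ∃ v, x = x₀ + v := ⟨x - x₀, by simp⟩
    have hv : ‖v‖ < δ := by simpa using hx
    simp only [add_sub_cancel_left]
    obtain ⟨h0, hy⟩ := hα v hv.le
    set y := α v with hydef
    -- the key estimate
    have key : ∀ h : E, ‖h‖ ≤ δ → ‖v + h‖ ≤ δ →
        ‖α (v + h) 1 - (y 1 + G (x₀ + v, y 1) h)‖ ≤
          gronwallBound 0 M (2 * M ^ 3 * ‖h‖ ^ 2) 1 := by
      intro h hh hvh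
      obtain ⟨g0, hg⟩ := hα (v + h) hvh
      set P : ℝ → E × F := fun t => (x₀ + t • v, y t) with hP
      have hPd : ∀ t ∈ Icc (0 : ℝ) 1, HasDerivWithinAt P (v, G (P t) v) (Icc 0 1) t := by
        intro t ht
        refine HasDerivWithinAt.prodMk ?_ (hy t ht).2
        have := ((hasDerivWithinAt_id t (Icc 0 1)).smul_const v).const_add x₀
        simpa using this
      set z : ℝ → F := fun t => y t + t • G (P t) h with hz
      have hzd : ∀ t ∈ Icc (0 : ℝ) 1, HasDerivWithinAt z
          (G (P t) v + (t • fderiv ℝ G (P t) (v, G (P t) v) h + G (P t) h)) (Icc 0 1) t := by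
        intro t ht
        refine (hy t ht).2.add ?_
        have h1 : HasDerivWithinAt (fun t => G (P t)) (fderiv ℝ G (P t) (v, G (P t) v))
            (Icc 0 1) t := (hdiff (P t)).hasFDerivAt.comp_hasDerivWithinAt t (hPd t ht)
        have h2 := h1.clm_apply (hasDerivWithinAt_const t (Icc 0 1) h)
        have h3 := (hasDerivWithinAt_id t (Icc 0 1)).smul h2
        simpa [Pi.smul_def'] using h3
      have hsub : closedBall y₀ (ε / 2) ⊆ closedBall y₀ ε :=
        closedBall_subset_closedBall (by linarith)
      have hPmem : ∀ t ∈ Icc (0 : ℝ) 1, P t ∈ closedBall (x₀, y₀) ε := fun t ht =>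
        hmem v hv.le t ht _ (hsub (hy t ht).1)
      have hGh : ∀ t ∈ Icc (0 : ℝ) 1, ‖G (P t) h‖ ≤ M * ‖h‖ := fun t ht =>
        (ContinuousLinearMap.le_opNorm _ _).trans (by gcongr; exact hGM _ (hPmem t ht))
      have hzmem : ∀ t ∈ Icc (0 : ℝ) 1, z t ∈ closedBall y₀ ε := by
        intro t ht
        have h1 := (hy t ht).1
        rw [mem_closedBall, dist_eq_norm] at h1 ⊢
        have h2 : ‖t • G (P t) h‖ ≤ 1 * (M * ‖h‖) := by
          rw [norm_smul, Real.norm_of_nonneg ht.1]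
          gcongr
          · exact ht.2
          · exact hGh t ht
        have h3 : M * ‖h‖ ≤ M * δ := by gcongr
        have : z t - y₀ = (y t - y₀) + t • G (P t) h := by simp only [hz]; abel
        rw [this]
        refine (norm_add_le _ _).trans ?_
        linarith
      have hci : ∀ t ∈ Ico (0 : ℝ) 1, Icc (0 : ℝ) 1 ∈ 𝓝[≥] t := fun t ht => Icc_mem_nhdsGE_of_mem ht
      have main := dist_le_of_approx_trajectories_ODE_of_mem (a := 0) (b := 1) (K := M)
        (v := fun t y => G (x₀ + t • (v + h), y) (v + h)) (s := fun _ => closedBall y₀ ε)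
        (f := α (v + h)) (g := z) (εf := 0) (εg := 2 * M ^ 3 * ‖h‖ ^ 2) (δ := 0)
        (fun t ht => hvlip _ hvh t (Ico_subset_Icc_self ht))
        (fun t ht => (hg t ht).2.continuousWithinAt)
        (fun t ht => (hg t (Ico_subset_Icc_self ht)).2.mono_of_mem_nhdsWithin (hci t ht))
        (fun t ht => by simp)
        (fun t ht => hsub (hg t (Ico_subset_Icc_self ht)).1)
        (fun t ht => (hzd t ht).continuousWithinAt)
        (fun t ht => (hzd t (Ico_subset_Icc_self ht)).mono_of_mem_nhdsWithin (hci t ht))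
        ?_
        (fun t ht => hzmem t (Ico_subset_Icc_self ht))
        (by simp [hz, g0, h0]) 1 (by simp)
      · simpa [dist_eq_norm, hz, hP] using main
      · intro t ht'
        have ht := Ico_subset_Icc_self ht'
        set p := P t with hp
        set q : E × F := (x₀ + t • (v + h), z t) with hq
        have hqp : q - p = t • (h, G p h) := by
          simp [hq, hp, hP, hz, smul_add]
        have hR := hTay p (hPmem t ht) q (hmem _ hvh t ht _ (hzmem t ht))
        have hpair : ‖((h, G p h) : E × F)‖ ≤ M * ‖h‖ := by
          rw [Prod.norm_def]
          refine max_le ?_ (hGh t ht)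
          nlinarith [norm_nonneg h]
        have hk : ‖q - p‖ ≤ M * ‖h‖ := by
          rw [hqp, norm_smul, Real.norm_of_nonneg ht.1]
          calc t * ‖((h, G p h) : E × F)‖ ≤ 1 * (M * ‖h‖) := by gcongr; exact ht.2
            _ = _ := by ring
        set R := G q - G p - fderiv ℝ G p (q - p) with hRdef
        have hGq : G q = G p + t • fderiv ℝ G p (h, G p h) + R := by
          rw [hRdef, hqp, map_smul]; abel
        have hident : G p v + (t • fderiv ℝ G p (v, G p v) h + G p h) - G q (v + h)
            = -(t • fderiv ℝ G p (h, G p h) h) - R (v + h) := by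
          rw [hGq, flat p v h]
          simp only [_root_.add_apply, _root_.smul_apply, map_add]
          abel
        rw [dist_eq_norm, hident]
        have e1 : ‖t • fderiv ℝ G p (h, G p h) h‖ ≤ M ^ 3 * ‖h‖ ^ 2 := by
          rw [norm_smul, Real.norm_of_nonneg ht.1]
          calc t * ‖fderiv ℝ G p (h, G p h) h‖
              ≤ 1 * ((M * (M * ‖h‖)) * ‖h‖) := by
                gcongr
                · exact ht.2
                · refine (ContinuousLinearMap.le_opNorm _ _).trans ?_
                  gcongr
                  refine (ContinuousLinearMap.le_opNorm _ _).trans ?_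
                  gcongr
                  exact hDM p (hPmem t ht)
            _ = 1 * (M ^ 2 * ‖h‖ ^ 2) := by ring
            _ ≤ M * (M ^ 2 * ‖h‖ ^ 2) := by gcongr
            _ = _ := by ring
        have e2 : ‖R (v + h)‖ ≤ M ^ 3 * ‖h‖ ^ 2 := by
          refine (ContinuousLinearMap.le_opNorm _ _).trans ?_
          calc ‖R‖ * ‖v + h‖ ≤ (M * (M * ‖h‖) ^ 2) * 1 := by
                gcongr
                · exact hR.trans (by gcongr)
                · linarith
            _ = _ := by ring
        calc _ ≤ ‖t • fderiv ℝ G p (h, G p h) h‖ + ‖R (v + h)‖ := by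
              refine (norm_sub_le _ _).trans ?_
              rw [norm_neg]
          _ ≤ _ := by linarith
    rw [hasFDerivAt_iff_isLittleO_nhds_zero]
    refine Asymptotics.IsBigO.trans_isLittleO ?_
      (Asymptotics.isLittleO_norm_pow_id (E' := E) (n := 2) (by norm_num))
    refine Asymptotics.IsBigO.of_bound (2 * M ^ 3 / M * (Real.exp M - 1)) ?_
    have n1 : ∀ᶠ h : E in 𝓝 0, ‖h‖ < δ :=
      continuous_norm.continuousAt.eventually_lt continuousAt_const (by simpa using hδ)
    have n2 : ∀ᶠ h : E in 𝓝 0, ‖v + h‖ < δ :=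
      (by fun_prop : Continuous fun h : E => ‖v + h‖).continuousAt.eventually_lt
        continuousAt_const (by simpa using hv)
    filter_upwards [n1, n2] with h h1 h2
    have := key h h1.le h2.le
    rw [gronwallBound_of_K_ne_0 hM0.ne'] at this
    have e : x₀ + v + h - x₀ = v + h := by abel
    rw [e, sub_sub, add_sub_cancel_left]
    refine this.trans (le_of_eq ?_)
    simp only [norm_pow, norm_norm]
    ring_nf

open Set Metric Filter Topology in
theorem frobenius_flat {E F : Type*} [NormedAddCommGroup E] [NormedSpace ℝ E]
    [NormedAddCommGroup F] [NormedSpace ℝ F]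
    (G : E × F → E →L[ℝ] F) (hG : Differentiable ℝ G) (x₀ : E) (f : E → F)
    (hf : ∀ᶠ x in 𝓝 x₀, HasFDerivAt f (G (x, f x)) x) (a b : E) :
    fderiv ℝ G (x₀, f x₀) (a, G (x₀, f x₀) a) b = fderiv ℝ G (x₀, f x₀) (b, G (x₀, f x₀) b) a := by
  have h0 := hf.self_of_nhds
  have h1 : HasFDerivAt (fun x => G (x, f x)) _ x₀ :=
    HasFDerivAt.comp x₀ (hG (x₀, f x₀)).hasFDerivAt ((hasFDerivAt_id x₀).prodMk h0)
  have := second_derivative_symmetric_of_eventually hf h1 a b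
  simpa using this

open Set Metric Filter Topology in
/-- Coefficient arrays as continuous linear maps. -/
noncomputable def coeffCLM (m N : ℕ) :
    (Fin N → Fin m → ℝ) →L[ℝ] ((Fin m → ℝ) →L[ℝ] (Fin N → ℝ)) :=
  LinearMap.toContinuousLinearMap
    ((LinearMap.toContinuousLinearMap (𝕜 := ℝ) (E := Fin m → ℝ) (F' := Fin N → ℝ)).toLinearMap ∘ₗ
      (Matrix.toLin' (R := ℝ) (m := Fin N) (n := Fin m)).toLinearMap)

theorem coeffCLM_apply (m N : ℕ) (c : Fin N → Fin m → ℝ) (v : Fin m → ℝ) (A : Fin N) :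
    coeffCLM m N c v A = ∑ μ, c A μ * v μ := rfl

theorem coeffCLM_single (m N : ℕ) (c : Fin N → Fin m → ℝ) (μ : Fin m) (A : Fin N) :
    coeffCLM m N c (Pi.single μ 1) A = c A μ := by
  rw [coeffCLM_apply]
  simp [Pi.single_apply]

theorem clm_ext_single {m : ℕ} {W : Type*} [NormedAddCommGroup W] [NormedSpace ℝ W]
    {S T : (Fin m → ℝ) →L[ℝ] W} (h : ∀ μ, S (Pi.single μ 1) = T (Pi.single μ 1)) : S = T := by
  apply ContinuousLinearMap.coe_injective
  apply LinearMap.pi_ext'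
  intro i
  ext
  simpa using h i

/-- The coordinate expression of the horizontal derivative of the coefficients. -/
theorem coord_expr (m N : ℕ) (Γ : (Fin m → ℝ) × (Fin N → ℝ) → Fin N → Fin m → ℝ)
    (hΓ : Differentiable ℝ Γ) (p : (Fin m → ℝ) × (Fin N → ℝ)) (A : Fin N) (μ ν : Fin m) :
    fderiv ℝ (fun q => coeffCLM m N (Γ q)) p
        (Pi.single μ 1, coeffCLM m N (Γ p) (Pi.single μ 1)) (Pi.single ν 1) A
      = fderiv ℝ (fun q => Γ q A ν) p (Pi.single μ 1, 0)
        + ∑ B : Fin N, Γ p B μ * fderiv ℝ (fun q => Γ q A ν) p (0, Pi.single B 1) := by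
  have h1 : HasFDerivAt (fun q => coeffCLM m N (Γ q)) ((coeffCLM m N).comp (fderiv ℝ Γ p)) p :=
    (coeffCLM m N).hasFDerivAt.comp p (hΓ p).hasFDerivAt
  have h2 : ∀ w, fderiv ℝ (fun q => Γ q A ν) p w = fderiv ℝ Γ p w A ν := by
    intro w
    have := hasFDerivAt_pi'.1 (hasFDerivAt_pi'.1 (hΓ p).hasFDerivAt A) ν
    rw [this.fderiv]
    rfl
  rw [h1.fderiv, ContinuousLinearMap.comp_apply, coeffCLM_single, ← h2]
  have h3 : ((Pi.single μ 1, coeffCLM m N (Γ p) (Pi.single μ 1)) : (Fin m → ℝ) × (Fin N → ℝ))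
      = (Pi.single μ 1, 0) + ∑ B : Fin N, Γ p B μ • (0, Pi.single B 1) := by
    ext i
    · simp [Prod.fst_sum]
    · simp only [coeffCLM_single]
      simp [Prod.snd_sum, Pi.single_apply]
  rw [h3, map_add, map_sum]
  simp only [map_smul, smul_eq_mul]

theorem flat_iff (m N : ℕ) (Γ : (Fin m → ℝ) × (Fin N → ℝ) → Fin N → Fin m → ℝ)
    (hΓ : Differentiable ℝ Γ) (p : (Fin m → ℝ) × (Fin N → ℝ)) :
    (∀ a b, fderiv ℝ (fun q => coeffCLM m N (Γ q)) p (a, coeffCLM m N (Γ p) a) b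
      = fderiv ℝ (fun q => coeffCLM m N (Γ q)) p (b, coeffCLM m N (Γ p) b) a) ↔
    ∀ (A : Fin N) (μ ν : Fin m),
      fderiv ℝ (fun q => Γ q A ν) p (Pi.single μ 1, 0)
        + ∑ B : Fin N, Γ p B μ * fderiv ℝ (fun q => Γ q A ν) p (0, Pi.single B 1)
        - fderiv ℝ (fun q => Γ q A μ) p (Pi.single ν 1, 0)
        - ∑ B : Fin N, Γ p B ν * fderiv ℝ (fun q => Γ q A μ) p (0, Pi.single B 1) = 0 := by
  constructor
  · intro h A μ ν
    have := congrFun (h (Pi.single μ 1) (Pi.single ν 1)) A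
    rw [coord_expr m N Γ hΓ, coord_expr m N Γ hΓ] at this
    linarith
  · intro h
    let S : (Fin m → ℝ) →L[ℝ] (Fin m → ℝ) →L[ℝ] (Fin N → ℝ) :=
      (fderiv ℝ (fun q => coeffCLM m N (Γ q)) p).comp
        ((ContinuousLinearMap.id ℝ _).prod (coeffCLM m N (Γ p)))
    have hS : S = S.flip := by
      apply clm_ext_single
      intro μ
      apply clm_ext_single
      intro ν
      ext A
      change fderiv ℝ (fun q => coeffCLM m N (Γ q)) p
          (Pi.single μ 1, coeffCLM m N (Γ p) (Pi.single μ 1)) (Pi.single ν 1) A =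
        fderiv ℝ (fun q => coeffCLM m N (Γ q)) p
          (Pi.single ν 1, coeffCLM m N (Γ p) (Pi.single ν 1)) (Pi.single μ 1) A
      rw [coord_expr m N Γ hΓ, coord_expr m N Γ hΓ]
      linarith [h A μ ν]
    intro a b
    exact congrArg (fun T => T a b) hS

/-- A jet field (connection) `Γ` on the trivial bundle `ℝᵐ × ℝᴺ → ℝᵐ` is integrable
(admits an integral section through every point) if and only if its curvature vanishes
identically. -/
theorem jetField_integrable_iff_curvature_zero (m N : ℕ)
    (Γ : (Fin m → ℝ) × (Fin N → ℝ) → Fin N → Fin m → ℝ)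
    (hΓ : ContDiff ℝ (⊤ : ℕ∞) Γ) :
    (∀ (x₀ : Fin m → ℝ) (y₀ : Fin N → ℝ),
      ∃ U : Set (Fin m → ℝ), IsOpen U ∧ x₀ ∈ U ∧
        ∃ f : (Fin m → ℝ) → (Fin N → ℝ), ContDiffOn ℝ 1 f U ∧ f x₀ = y₀ ∧
          ∀ x ∈ U, ∀ (A : Fin N) (μ : Fin m),
            fderiv ℝ (fun x' => f x' A) x (Pi.single μ 1) = Γ (x, f x) A μ)
    ↔
    (∀ (p : (Fin m → ℝ) × (Fin N → ℝ)) (A : Fin N) (μ ν : Fin m),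
      fderiv ℝ (fun q => Γ q A ν) p (Pi.single μ 1, 0)
        + ∑ B : Fin N, Γ p B μ * fderiv ℝ (fun q => Γ q A ν) p (0, Pi.single B 1)
        - fderiv ℝ (fun q => Γ q A μ) p (Pi.single ν 1, 0)
        - ∑ B : Fin N, Γ p B ν * fderiv ℝ (fun q => Γ q A μ) p (0, Pi.single B 1) = 0) := by
  have hd : Differentiable ℝ Γ := hΓ.differentiable (by simp)
  have hG : ContDiff ℝ 2 (fun q => coeffCLM m N (Γ q)) :=
    (coeffCLM m N).contDiff.comp (contDiff_infty.1 hΓ 2)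
  have hGd : Differentiable ℝ (fun q => coeffCLM m N (Γ q)) := hG.differentiable (by norm_num)
  constructor
  · rintro h ⟨x₀, y₀⟩
    rw [← flat_iff m N Γ hd]
    obtain ⟨U, hU, hxU, f, hf, rfl, hfΓ⟩ := h x₀ y₀
    refine frobenius_flat (fun q => coeffCLM m N (Γ q)) hGd x₀ f ?_
    filter_upwards [hU.mem_nhds hxU] with x hx
    have hfx : DifferentiableAt ℝ f x :=
      (hf.differentiableOn (by norm_num)).differentiableAt (hU.mem_nhds hx)
    have e : fderiv ℝ f x = coeffCLM m N (Γ (x, f x)) := by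
      apply clm_ext_single
      intro μ
      ext A
      rw [coeffCLM_single, ← hfΓ x hx A μ, (hasFDerivAt_pi'.1 hfx.hasFDerivAt A).fderiv]
      rfl
    rw [← e]
    exact hfx.hasFDerivAt
  · intro h x₀ y₀
    obtain ⟨δ, hδ, f, hf0, hf⟩ := frobenius_exists (fun q => coeffCLM m N (Γ q)) hG
      (fun p => (flat_iff m N Γ hd p).2 (h p)) x₀ y₀
    refine ⟨Metric.ball x₀ δ, Metric.isOpen_ball, Metric.mem_ball_self hδ, f, ?_, hf0, ?_⟩
    · have hc : ContinuousOn f (Metric.ball x₀ δ) := fun x hx =>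
        (hf x hx).continuousAt.continuousWithinAt
      have hone : (1 : WithTop ℕ∞) = 0 + 1 := by norm_num
      rw [hone, contDiffOn_succ_iff_fderiv_of_isOpen Metric.isOpen_ball]
      refine ⟨fun x hx => (hf x hx).differentiableAt.differentiableWithinAt, by simp, ?_⟩
      rw [contDiffOn_zero]
      have : ContinuousOn (fun x => coeffCLM m N (Γ (x, f x))) (Metric.ball x₀ δ) :=
        hG.continuous.comp_continuousOn (continuousOn_id.prodMk hc)
      exact this.congr fun x hx => (hf x hx).fderiv
    · intro x hx A μ
      rw [(hasFDerivAt_pi'.1 (hf x hx) A).fderiv, ← coeffCLM_single m N (Γ (x, f x))]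
      rfl
end

section
/- Let Gᴬ_{ρν} : ℝᵐ × ℝᴺ × ℝ^{N×m} → ℝ (A = 1,…,N; ρ, ν = 1,…,m) be smooth functions of the variables (xᵘ, yᴬ, vᴬ_μ). The following are equivalent: (i) for every (x₀, y₀, v₀) ∈ ℝᵐ × ℝᴺ × ℝ^{N×m} there exist an open neighborhood U of x₀ and a C² map f : U → ℝᴺ with f(x₀) = y₀, ∂fᴬ/∂xᵘ(x₀) = v₀ᴬ_μ, and ∂²fᴬ/∂x^ρ∂x^ν(x) = Gᴬ_{ρν}(x, f(x), Df(x)) for all x ∈ U and all A, ρ, ν; (ii) identically on ℝᵐ × ℝᴺ × ℝ^{N×m}, for all A (or B), μ, η, ρ: Gᴮ_{ημ} − Gᴮ_{μη} = 0 and ∂Gᴮ_{ηρ}/∂xᵘ + Σ_A vᴬ_μ ∂Gᴮ_{ηρ}/∂yᴬ + Σ_{A,γ} Gᴬ_{μγ} ∂Gᴮ_{ηρ}/∂vᴬ_γ − ∂Gᴮ_{μρ}/∂x^η − Σ_A vᴬ_η ∂Gᴮ_{μρ}/∂yᴬ − Σ_{A,γ} Gᴬ_{ηγ} ∂Gᴮ_{μρ}/∂vᴬ_γ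 = 0. -/
open Set Metric Filter Topology NNReal

theorem gronwall_lin (L ε : ℝ) : gronwallBound 0 L ε 1 = ε * gronwallBound 0 L 1 1 := by
  unfold gronwallBound
  split_ifs <;> ring

theorem ray_exists {X Z : Type*} [NormedAddCommGroup X] [NormedSpace ℝ X]
    [NormedAddCommGroup Z] [NormedSpace ℝ Z] [CompleteSpace Z]
    (F : X × Z → X →L[ℝ] Z) (M K : ℝ≥0) (hM : ∀ p, ‖F p‖ ≤ M) (hK : LipschitzWith K F)
    (x₀ : X) (z₀ : Z) (u : X) :
    ∃ α : ℝ → Z, α 0 = z₀ ∧ ∀ t ∈ Icc (0 : ℝ) 1,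
      HasDerivWithinAt α (F (x₀ + t • u, α t) u) (Icc 0 1) t := by
  have hP : IsPicardLindelof (fun t z => F (x₀ + t • u, z) u) (tmin := 0) (tmax := 1)
      ⟨0, by simp⟩ z₀ (M * ‖u‖₊) 0 (M * ‖u‖₊) (K * ‖u‖₊) := by
    refine ⟨?_, ?_, ?_, ?_⟩
    · intro t ht
      refine LipschitzOnWith.of_dist_le_mul fun a _ b _ => ?_
      rw [dist_eq_norm, ← _root_.sub_apply]
      refine (ContinuousLinearMap.le_opNorm _ _).trans ?_
      have h := hK.dist_le_mul (x₀ + t • u, a) (x₀ + t • u, b)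
      rw [dist_eq_norm, Prod.dist_eq, dist_self, max_eq_right dist_nonneg] at h
      calc _ ≤ (K * dist a b) * ‖u‖ := by gcongr
        _ = _ := by push_cast; ring
    · intro z _
      have := hK.continuous
      fun_prop
    · intro t _ z _
      refine (ContinuousLinearMap.le_opNorm _ _).trans ?_
      push_cast
      gcongr
      exact hM _
    · simp
  exact hP.exists_eq_forall_mem_Icc_hasDerivWithinAt₀

theorem frob_core {X Z : Type*} [NormedAddCommGroup X] [NormedSpace ℝ X]
    [NormedAddCommGroup Z] [NormedSpace ℝ Z] [CompleteSpace Z]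
    (F : X × Z → X →L[ℝ] Z) (hd : Differentiable ℝ F) (M K K' : ℝ≥0)
    (hM : ∀ p, ‖F p‖ ≤ M) (hK : LipschitzWith K F) (hK' : LipschitzWith K' (fderiv ℝ F))
    (x₀ : X) (z₀ : Z) (r : ℝ) (hr : 0 < r)
    (hint : ∀ p ∈ ball (x₀, z₀) r, ∀ u w,
      fderiv ℝ F p (u, F p u) w = fderiv ℝ F p (w, F p w) u) :
    ∃ z : X → Z, z x₀ = z₀ ∧ ∃ ε > 0, ∀ x ∈ ball x₀ ε, HasFDerivAt z (F (x, z x)) x := by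
  choose ζ ζ0 hζ using ray_exists F M K hM hK x₀ z₀
  have hbd : ∀ u, ∀ t ∈ Icc (0 : ℝ) 1, ‖ζ u t - z₀‖ ≤ M * ‖u‖ := by
    intro u t ht
    have h := norm_image_sub_le_of_norm_deriv_le_segment' (hζ u) (C := M * ‖u‖)
      (fun s _ => (ContinuousLinearMap.le_opNorm _ _).trans (by gcongr; exact hM _)) t ht
    rw [ζ0, sub_zero] at h
    refine h.trans (mul_le_of_le_one_right (by positivity) ht.2)
  refine ⟨fun x => ζ (x - x₀) 1, ?_, r / (M + 1), by positivity, ?_⟩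
  · have := hbd 0 1 (by simp)
    simp only [norm_zero, mul_zero, norm_le_zero_iff] at this
    simpa [sub_eq_zero] using this
  intro x hx
  obtain ⟨a, rfl⟩ : ∃ a, x = x₀ + a := ⟨x - x₀, by abel⟩
  have ha : ‖a‖ * (M + 1) < r := by
    rw [mem_ball, dist_eq_norm, lt_div_iff₀ (by positivity)] at hx
    simpa using hx
  have hmem : ∀ t ∈ Icc (0 : ℝ) 1, (x₀ + t • a, ζ a t) ∈ ball (x₀, z₀) r := by
    intro t ht
    rw [mem_ball, Prod.dist_eq, dist_eq_norm, dist_eq_norm]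
    have h1 := hbd a t ht
    have h2 : ‖t • a‖ ≤ ‖a‖ := by
      rw [norm_smul, Real.norm_of_nonneg ht.1]
      exact mul_le_of_le_one_left (by positivity) ht.2
    have h3 : 0 ≤ M * ‖a‖ := by positivity
    have h4 := norm_nonneg a
    simp only [add_sub_cancel_left]
    refine max_lt (by nlinarith) (by nlinarith)
  have hdK : ∀ p, ‖fderiv ℝ F p‖ ≤ K := fun p => norm_fderiv_le_of_lipschitz ℝ hK
  have htay : ∀ p w, ‖F (p + w) - F p - fderiv ℝ F p w‖ ≤ K' * ‖w‖ * ‖w‖ := by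
    intro p w
    have h := (convex_closedBall p ‖w‖).norm_image_sub_le_of_norm_fderiv_le' (𝕜 := ℝ) (f := F)
      (φ := fderiv ℝ F p) (C := K' * ‖w‖) (x := p) (y := p + w) (fun q _ => hd q)
      (fun q hq => by
        rw [← dist_eq_norm]
        exact (hK'.dist_le_mul q p).trans (by gcongr; exact hq))
      (by simp) (by simp)
    simpa using h
  set C : ℝ := K * (1 + M) + K' * (1 + M) ^ 2 * (‖a‖ + 1) with hC
  set L : ℝ≥0 := K * (‖a‖₊ + 1) with hL
  have key : ∀ u : X, ‖u‖ ≤ 1 →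
      ‖ζ (a + u) 1 - ζ a 1 - F (x₀ + a, ζ a 1) u‖ ≤ C * gronwallBound 0 L 1 1 * ‖u‖ ^ 2 := by
    intro u hu
    have hη : ∀ t ∈ Icc (0 : ℝ) 1, HasDerivWithinAt
        (fun t => ζ a t + t • F (x₀ + t • a, ζ a t) u)
        (F (x₀ + t • a, ζ a t) a + (t • fderiv ℝ F (x₀ + t • a, ζ a t)
          (a, F (x₀ + t • a, ζ a t) a) u + F (x₀ + t • a, ζ a t) u)) (Icc 0 1) t := by
      intro t ht
      have h1 : HasDerivWithinAt (fun t : ℝ => x₀ + t • a) a (Icc 0 1) t := by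
        simpa using (((hasDerivAt_id t).smul_const a).const_add x₀).hasDerivWithinAt
      have h2 := h1.prodMk (hζ a t ht)
      have h3 := (hd (x₀ + t • a, ζ a t)).hasFDerivAt.comp_hasDerivWithinAt t h2
      have h4 := h3.clm_apply (hasDerivWithinAt_const t (Icc (0:ℝ) 1) u)
      have h5 := (hζ a t ht).add ((hasDerivWithinAt_id t _).smul h4)
      refine HasDerivWithinAt.congr_deriv h5 ?_
      simp
    have hIci : ∀ t ∈ Ico (0 : ℝ) 1, 𝓝[Ici t] t ≤ 𝓝[Icc 0 1] t := by
      intro t ht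
      rw [nhdsWithin_le_iff]
      exact mem_of_superset (Icc_mem_nhdsGE ht.2) (Icc_subset_Icc_left ht.1)
    have hG := dist_le_of_approx_trajectories_ODE (a := 0) (b := 1) (K := L)
      (v := fun t z => F (x₀ + t • (a + u), z) (a + u)) (δ := 0) (εf := C * ‖u‖ ^ 2) (εg := 0)
      (f := fun t => ζ a t + t • F (x₀ + t • a, ζ a t) u) (g := ζ (a + u))
      (hv := ?_)
      (hf := fun t ht => (hη t ht).continuousWithinAt)
      (hf' := fun t ht => (hη t (Ico_subset_Icc_self ht)).mono_of_mem_nhdsWithin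
        (hIci t ht self_mem_nhdsWithin))
      (f_bound := ?_)
      (hg := fun t ht => (hζ (a + u) t ht).continuousWithinAt)
      (hg' := fun t ht => (hζ (a + u) t (Ico_subset_Icc_self ht)).mono_of_mem_nhdsWithin
        (hIci t ht self_mem_nhdsWithin))
      (g_bound := fun t ht => by simp) (ha := by simp [ζ0]) 1 (by simp)
    · rw [add_zero, sub_zero, gronwall_lin, dist_comm, dist_eq_norm] at hG
      simp only [one_smul] at hG
      rw [sub_sub]
      exact hG.trans (le_of_eq (by ring))
    · intro t
      refine LipschitzWith.of_dist_le_mul fun b c => ?_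
      rw [dist_eq_norm, ← _root_.sub_apply]
      refine (ContinuousLinearMap.le_opNorm _ _).trans ?_
      have h := hK.dist_le_mul (x₀ + t • (a + u), b) (x₀ + t • (a + u), c)
      rw [dist_eq_norm, Prod.dist_eq, dist_self, max_eq_right dist_nonneg] at h
      calc _ ≤ (K * dist b c) * (‖a‖ + 1) := by
            gcongr
            exact (norm_add_le _ _).trans (by gcongr)
        _ = _ := by rw [hL]; push_cast; ring
    · intro t ht
      have ht' := Ico_subset_Icc_self ht
      set p : X × Z := (x₀ + t • a, ζ a t) with hp
      set w : X × Z := (u, F p u) with hw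
      have hwn : ‖w‖ ≤ (1 + M) * ‖u‖ := by
        have h1 : ‖F p u‖ ≤ M * ‖u‖ :=
          (ContinuousLinearMap.le_opNorm _ _).trans (by gcongr; exact hM _)
        have h2 : 0 ≤ M * ‖u‖ := by positivity
        rw [hw, Prod.norm_def]
        refine max_le ?_ ?_ <;> simp only <;> nlinarith [norm_nonneg u]
      have hq : (x₀ + t • (a + u), ζ a t + t • F p u) = p + t • w := by
        simp [hp, hw, add_assoc]
      have htn : ‖t • w‖ ≤ (1 + M) * ‖u‖ := by
        rw [norm_smul, Real.norm_of_nonneg ht.1]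
        exact (mul_le_of_le_one_left (by positivity) ht.2.le).trans hwn
      rw [dist_eq_norm, hq, hint p (hmem t ht') a u]
      set R := F (p + t • w) - F p - fderiv ℝ F p (t • w) with hR
      have hRn : ‖R‖ ≤ K' * ((1 + M) * ‖u‖) * ((1 + M) * ‖u‖) :=
        (htay p (t • w)).trans (by gcongr)
      have heq : F p a + (t • fderiv ℝ F p w a + F p u) - F (p + t • w) (a + u)
          = -(fderiv ℝ F p (t • w) u + R (a + u)) := by
        rw [hR]
        simp only [_root_.sub_apply, map_add, map_smul,
          _root_.smul_apply]
        abel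
      rw [heq, norm_neg]
      have e1 : ‖fderiv ℝ F p (t • w) u‖ ≤ K * ((1 + M) * ‖u‖) * ‖u‖ := by
        refine (ContinuousLinearMap.le_opNorm _ _).trans ?_
        gcongr
        refine (ContinuousLinearMap.le_opNorm _ _).trans ?_
        gcongr
        exact hdK p
      have e2 : ‖R (a + u)‖ ≤ K' * ((1 + M) * ‖u‖) * ((1 + M) * ‖u‖) * (‖a‖ + 1) := by
        refine (ContinuousLinearMap.le_opNorm _ _).trans ?_
        gcongr
        exact (norm_add_le _ _).trans (by gcongr)
      refine (norm_add_le _ _).trans ((add_le_add e1 e2).trans (le_of_eq ?_))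
      rw [hC]; ring
  rw [hasFDerivAt_iff_isLittleO_nhds_zero]
  have hO : (fun h : X => ζ (x₀ + a + h - x₀) 1 - ζ (x₀ + a - x₀) 1
      - (F (x₀ + a, ζ (x₀ + a - x₀) 1)) h) =O[𝓝 0] fun h : X => ‖h‖ ^ 2 := by
    refine Asymptotics.IsBigO.of_bound (C * gronwallBound 0 L 1 1) ?_
    filter_upwards [closedBall_mem_nhds (0 : X) one_pos] with u hu
    have e1 : x₀ + a + u - x₀ = a + u := by abel
    have e2 : x₀ + a - x₀ = a := by abel
    rw [e1, e2]
    refine (key u (by simpa using hu)).trans (le_of_eq ?_)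
    simp
  exact hO.trans_isLittleO (Asymptotics.isLittleO_norm_pow_id one_lt_two)

theorem cutoff_exists {E Y : Type*} [NormedAddCommGroup E] [NormedSpace ℝ E]
    [FiniteDimensional ℝ E] [NormedAddCommGroup Y] [NormedSpace ℝ Y]
    (F : E → Y) (hF : ContDiff ℝ 2 F) (c : E) :
    ∃ F' : E → Y, ContDiff ℝ 2 F' ∧ HasCompactSupport F' ∧
      ∀ p ∈ ball c 1, F' =ᶠ[𝓝 p] F := by
  obtain ⟨χ, hχ⟩ : ∃ χ : ContDiffBump c, χ.rIn = 1 := ⟨⟨1, 2, one_pos, one_lt_two⟩, rfl⟩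
  refine ⟨fun p => χ p • F p, χ.contDiff.smul hF, χ.hasCompactSupport.smul_right, ?_⟩
  intro p hp
  filter_upwards [χ.eventuallyEq_one_of_mem_ball (by rwa [hχ])] with q hq
  simp [hq]

theorem cutoff_bounds {E Y : Type*} [NormedAddCommGroup E] [NormedSpace ℝ E]
    [FiniteDimensional ℝ E] [NormedAddCommGroup Y] [NormedSpace ℝ Y]
    (F : E → Y) (hc : ContDiff ℝ 2 F) (hs : HasCompactSupport F) :
    ∃ M K K' : ℝ≥0, (∀ p, ‖F p‖ ≤ M) ∧ LipschitzWith K F ∧ LipschitzWith K' (fderiv ℝ F) := by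
  obtain ⟨K, hK⟩ := hc.lipschitzWith_of_hasCompactSupport hs (by simp)
  have hc1 : ContDiff ℝ 1 (fderiv ℝ F) := hc.fderiv_right (by norm_num)
  obtain ⟨K', hK'⟩ := hc1.lipschitzWith_of_hasCompactSupport (hs.fderiv ℝ) (by simp)
  obtain ⟨M, hM⟩ := hs.exists_bound_of_continuous hc.continuous
  exact ⟨M.toNNReal, K, K', fun p => (hM p).trans (Real.le_coe_toNNReal M), hK, hK'⟩

theorem frob_local {X Z : Type*} [NormedAddCommGroup X] [NormedSpace ℝ X]
    [NormedAddCommGroup Z] [NormedSpace ℝ Z] [FiniteDimensional ℝ X] [FiniteDimensional ℝ Z]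
    (F : X × Z → X →L[ℝ] Z) (hF : ContDiff ℝ 2 F)
    (x₀ : X) (z₀ : Z)
    (hint : ∀ p, ∀ u w, fderiv ℝ F p (u, F p u) w = fderiv ℝ F p (w, F p w) u) :
    ∃ z : X → Z, z x₀ = z₀ ∧ ∃ ε > 0, ∀ x ∈ ball x₀ ε, HasFDerivAt z (F (x, z x)) x := by
  have : CompleteSpace Z := FiniteDimensional.complete ℝ Z
  obtain ⟨F', hc, hs, hev⟩ := cutoff_exists F hF (x₀, z₀)
  obtain ⟨M, K, K', hM, hK, hK'⟩ := cutoff_bounds F' hc hs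
  have hint' : ∀ p ∈ ball (x₀, z₀) 1, ∀ u w,
      fderiv ℝ F' p (u, F' p u) w = fderiv ℝ F' p (w, F' p w) u := by
    intro p hp u w
    rw [(hev p hp).fderiv_eq, (hev p hp).eq_of_nhds]
    exact hint p u w
  obtain ⟨z, hz0, ε, hε, hz⟩ := frob_core F' (hc.differentiable (by simp)) M K K'
    hM hK hK' x₀ z₀ 1 one_pos hint'
  have hcont : ContinuousAt (fun x => (x, z x)) x₀ :=
    continuousAt_id.prodMk (hz x₀ (mem_ball_self hε)).continuousAt
  have h1 : ∀ᶠ x in 𝓝 x₀, (x, z x) ∈ ball (x₀, z₀) 1 := by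
    refine hcont.eventually_mem ?_
    rw [hz0]
    exact ball_mem_nhds _ one_pos
  obtain ⟨δ, hδ, hδ'⟩ := Metric.eventually_nhds_iff_ball.1 (h1.and (ball_mem_nhds x₀ hε))
  refine ⟨z, hz0, δ, hδ, fun x hx => ?_⟩
  have h2 := hδ' x hx
  rw [← (hev _ h2.1).eq_of_nhds]
  exact hz x h2.2

theorem frob_contDiffOn {X Z : Type*} [NormedAddCommGroup X] [NormedSpace ℝ X]
    [NormedAddCommGroup Z] [NormedSpace ℝ Z]
    (F : X × Z → X →L[ℝ] Z) (hF : ContDiff ℝ 2 F) (z : X → Z) (U : Set X) (hU : IsOpen U)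
    (hz : ∀ x ∈ U, HasFDerivAt z (F (x, z x)) x) : ContDiffOn ℝ 2 z U := by
  have hd : DifferentiableOn ℝ z U := fun x hx => (hz x hx).differentiableAt.differentiableWithinAt
  have step : ∀ n : ℕ, n ≤ 2 → ContDiffOn ℝ n z U → ContDiffOn ℝ (n + 1) z U := by
    intro n hn h
    rw [contDiffOn_succ_iff_fderiv_of_isOpen hU]
    refine ⟨hd, by simp, ?_⟩
    have h2 : ContDiffOn ℝ n (fun x => F (x, z x)) U :=
      (hF.of_le (by exact_mod_cast hn)).comp_contDiffOn (contDiffOn_id.prodMk h)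
    exact h2.congr fun x hx => (hz x hx).fderiv
  have h0 : ContDiffOn ℝ (0 : ℕ) z U := by
    simpa using hd.continuousOn
  have h1 := step 0 (by norm_num) h0
  have h2 := step 1 (by norm_num) (by simpa using h1)
  have e : (((1 : ℕ) : WithTop ℕ∞) + 1) = 2 := by norm_num
  rwa [e] at h2

section sopde

variable {m N : ℕ}

/-- The `ρ`-th component of the jet field. -/
noncomputable def jetG (G : Fin N → Fin m → Fin m →
      ((Fin m → ℝ) × (Fin N → ℝ) × (Fin N → Fin m → ℝ)) → ℝ) (ρ : Fin m)
    (p : (Fin m → ℝ) × (Fin N → ℝ) × (Fin N → Fin m → ℝ)) :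
    (Fin N → ℝ) × (Fin N → Fin m → ℝ) :=
  (fun A => p.2.2 A ρ, fun A ν => G A ρ ν p)

/-- The connection form. -/
noncomputable def jetF (G : Fin N → Fin m → Fin m →
      ((Fin m → ℝ) × (Fin N → ℝ) × (Fin N → Fin m → ℝ)) → ℝ)
    (p : (Fin m → ℝ) × (Fin N → ℝ) × (Fin N → Fin m → ℝ)) :
    (Fin m → ℝ) →L[ℝ] (Fin N → ℝ) × (Fin N → Fin m → ℝ) :=
  ∑ ρ, (ContinuousLinearMap.proj ρ : (Fin m → ℝ) →L[ℝ] ℝ).smulRight (jetG G ρ p)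

variable (G : Fin N → Fin m → Fin m →
      ((Fin m → ℝ) × (Fin N → ℝ) × (Fin N → Fin m → ℝ)) → ℝ)

theorem jetF_apply (p) (u : Fin m → ℝ) : jetF G p u = ∑ ρ, u ρ • jetG G ρ p := by
  simp [jetF]

theorem jetF_single (p) (ρ : Fin m) : jetF G p (Pi.single ρ 1) = jetG G ρ p := by
  rw [jetF_apply, Finset.sum_eq_single ρ]
  · simp
  · intro b _ hb
    simp [Pi.single_eq_of_ne hb]
  · simp

theorem jetG_contDiff (hG : ∀ A ρ ν, ContDiff ℝ (⊤ : ℕ∞) (G A ρ ν)) (ρ : Fin m) :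
    ContDiff ℝ 2 (jetG G ρ) := by
  unfold jetG
  refine ContDiff.prodMk ?_ ?_
  · fun_prop
  · refine contDiff_pi.2 fun A => contDiff_pi.2 fun ν => ?_
    exact_mod_cast contDiff_infty.1 (hG A ρ ν) 2

theorem jetF_contDiff (hG : ∀ A ρ ν, ContDiff ℝ (⊤ : ℕ∞) (G A ρ ν)) :
    ContDiff ℝ 2 (jetF G) := by
  unfold jetF
  refine ContDiff.sum fun ρ _ => ?_
  exact contDiff_const.smulRight (jetG_contDiff G hG ρ)

theorem jetF_fderiv (hG : ∀ A ρ ν, ContDiff ℝ (⊤ : ℕ∞) (G A ρ ν)) (p w) (u : Fin m → ℝ) :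
    fderiv ℝ (jetF G) p w u = ∑ ρ, u ρ • fderiv ℝ (jetG G ρ) p w := by
  have h1 : HasFDerivAt (fun q => jetF G q u) _ p :=
    (((jetF_contDiff G hG).differentiable (by simp)) p).hasFDerivAt.clm_apply
      (hasFDerivAt_const u p)
  have h2 : HasFDerivAt (fun q => ∑ ρ, u ρ • jetG G ρ q)
      (∑ ρ, u ρ • fderiv ℝ (jetG G ρ) p) p :=
    HasFDerivAt.fun_sum fun ρ _ =>
      ((((jetG_contDiff G hG ρ).differentiable (by simp)) p).hasFDerivAt.const_smul (u ρ))
  simp_rw [jetF_apply] at h1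
  have h3 := congrArg (fun T => T w) (h1.unique h2)
  simpa using h3

theorem jetG_fderiv (hG : ∀ A ρ ν, ContDiff ℝ (⊤ : ℕ∞) (G A ρ ν)) (ρ : Fin m) (p w) :
    fderiv ℝ (jetG G ρ) p w = (fun A => w.2.2 A ρ, fun A ν => fderiv ℝ (G A ρ ν) p w) := by
  have h := (((jetG_contDiff G hG ρ).differentiable (by simp)) p).hasFDerivAt
  have h1 := h.fst
  have h2 := h.snd
  refine Prod.ext ?_ ?_
  · funext A
    have h3 := hasFDerivAt_pi'.1 h1 A
    have h4 : HasFDerivAt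
      (fun q : (Fin m → ℝ) × (Fin N → ℝ) × (Fin N → Fin m → ℝ) => q.2.2 A ρ)
      ((ContinuousLinearMap.proj ρ : (Fin m → ℝ) →L[ℝ] ℝ).comp
        ((ContinuousLinearMap.proj A : (Fin N → Fin m → ℝ) →L[ℝ] (Fin m → ℝ)).comp
        ((ContinuousLinearMap.snd ℝ (Fin N → ℝ) (Fin N → Fin m → ℝ)).comp
          (ContinuousLinearMap.snd ℝ (Fin m → ℝ) ((Fin N → ℝ) × (Fin N → Fin m → ℝ)))))) p :=
      ((ContinuousLinearMap.proj ρ : (Fin m → ℝ) →L[ℝ] ℝ).comp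
        ((ContinuousLinearMap.proj A : (Fin N → Fin m → ℝ) →L[ℝ] (Fin m → ℝ)).comp
        ((ContinuousLinearMap.snd ℝ (Fin N → ℝ) (Fin N → Fin m → ℝ)).comp
          (ContinuousLinearMap.snd ℝ (Fin m → ℝ) ((Fin N → ℝ) × (Fin N → Fin m → ℝ)))))).hasFDerivAt
    have h5 := congrArg (fun T => T w) (h3.unique h4)
    simpa using h5
  · funext A ν
    have h3 := hasFDerivAt_pi'.1 (hasFDerivAt_pi'.1 h2 A) ν
    have h4 : HasFDerivAt (G A ρ ν) (fderiv ℝ (G A ρ ν) p) p :=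
      ((hG A ρ ν).differentiable (by simp) p).hasFDerivAt
    have h5 := congrArg (fun T => T w) (h3.unique h4)
    simpa using h5

theorem total_deriv (T : (Fin m → ℝ) × (Fin N → ℝ) × (Fin N → Fin m → ℝ) →L[ℝ] ℝ) (μ : Fin m)
    (p : (Fin m → ℝ) × (Fin N → ℝ) × (Fin N → Fin m → ℝ)) :
    T (Pi.single μ 1, jetG G μ p) = T (Pi.single μ 1, 0, 0)
        + ∑ A : Fin N, p.2.2 A μ * T (0, Pi.single A 1, 0)
        + ∑ A : Fin N, ∑ γ : Fin m, G A μ γ p * T (0, 0, Pi.single A (Pi.single γ 1)) := by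
  have h : ((Pi.single μ 1, jetG G μ p) : (Fin m → ℝ) × (Fin N → ℝ) × (Fin N → Fin m → ℝ))
      = (Pi.single μ 1, 0, 0)
        + ∑ A : Fin N, p.2.2 A μ •
          ((0, Pi.single A 1, 0) : (Fin m → ℝ) × (Fin N → ℝ) × (Fin N → Fin m → ℝ))
        + ∑ A : Fin N, ∑ γ : Fin m, G A μ γ p •
          ((0, 0, Pi.single A (Pi.single γ 1)) :
            (Fin m → ℝ) × (Fin N → ℝ) × (Fin N → Fin m → ℝ)) := by
    refine Prod.ext ?_ (Prod.ext ?_ ?_)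
    · simp [Prod.fst_sum]
    · funext A
      simp [Prod.fst_sum, Prod.snd_sum, jetG, Finset.sum_apply, Pi.single_apply]
    · funext A γ
      simp only [Prod.snd_add, Prod.snd_sum, Prod.smul_snd, jetG, Pi.add_apply, Finset.sum_apply,
        Pi.smul_apply, Pi.zero_apply, smul_eq_mul, smul_zero, Finset.sum_const_zero, zero_add]
      rw [Finset.sum_eq_single A, Finset.sum_eq_single γ]
      · simp
      · intro b _ hb
        simp [Pi.single_eq_of_ne hb.symm]
      · simp
      · intro b _ hb
        simp [Pi.single_eq_of_ne hb.symm]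
      · simp
  rw [h]
  simp only [map_add, map_sum, map_smul, smul_eq_mul]

theorem jetF_integrable (hG : ∀ A ρ ν, ContDiff ℝ (⊤ : ℕ∞) (G A ρ ν))
    (hs : ∀ p B μ η, G B η μ p = G B μ η p)
    (hc : ∀ p B μ η ρ, fderiv ℝ (G B η ρ) p (Pi.single μ 1, jetG G μ p)
      = fderiv ℝ (G B μ ρ) p (Pi.single η 1, jetG G η p)) (p) (u w : Fin m → ℝ) :
    fderiv ℝ (jetF G) p (u, jetF G p u) w = fderiv ℝ (jetF G) p (w, jetF G p w) u := by
  have hdec : ∀ u : Fin m → ℝ, ((u, jetF G p u) :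
      (Fin m → ℝ) × (Fin N → ℝ) × (Fin N → Fin m → ℝ))
      = ∑ σ, u σ • ((Pi.single σ 1, jetG G σ p) :
      (Fin m → ℝ) × (Fin N → ℝ) × (Fin N → Fin m → ℝ)) := by
    intro u
    refine Prod.ext ?_ ?_
    · funext i
      simp [Prod.fst_sum, Finset.sum_apply, Pi.single_apply]
    · rw [jetF_apply, Prod.snd_sum]
      rfl
  have hsym : ∀ μ η, fderiv ℝ (jetG G η) p (Pi.single μ 1, jetG G μ p)
      = fderiv ℝ (jetG G μ) p (Pi.single η 1, jetG G η p) := by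
    intro μ η
    rw [jetG_fderiv G hG, jetG_fderiv G hG]
    refine Prod.ext ?_ ?_
    · funext A
      exact hs p A η μ
    · funext A ν
      exact hc p A μ η ν
  rw [jetF_fderiv G hG, jetF_fderiv G hG, hdec u, hdec w]
  simp only [map_sum, map_smul, Finset.smul_sum]
  rw [Finset.sum_comm]
  refine Finset.sum_congr rfl fun σ _ => Finset.sum_congr rfl fun ρ _ => ?_
  rw [hsym, smul_comm]

theorem sym_partial (h : (Fin m → ℝ) → ℝ) (d : Fin m → (Fin m → ℝ) → ℝ) (x₀ : Fin m → ℝ)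
    (hh : ∀ᶠ x in 𝓝 x₀, DifferentiableAt ℝ h x)
    (hd : ∀ᶠ x in 𝓝 x₀, ∀ ν, fderiv ℝ h x (Pi.single ν 1) = d ν x)
    (d' : Fin m → (Fin m → ℝ) →L[ℝ] ℝ) (hd' : ∀ ν, HasFDerivAt (d ν) (d' ν) x₀) (μ η : Fin m) :
    d' μ (Pi.single η 1) = d' η (Pi.single μ 1) := by
  let P : Fin m → ((Fin m → ℝ) →L[ℝ] ℝ) := fun ν => ContinuousLinearMap.proj ν
  have h1 : ∀ᶠ x in 𝓝 x₀, HasFDerivAt h (∑ ν, d ν x • P ν) x := by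
    filter_upwards [hh, hd] with x hx1 hx2
    have : fderiv ℝ h x = ∑ ν, d ν x • P ν := by
      refine ContinuousLinearMap.ext fun u => ?_
      have hu : u = ∑ ν, u ν • (Pi.single ν 1 : Fin m → ℝ) := by
        funext i
        simp [Finset.sum_apply, Pi.single_apply]
      conv_lhs => rw [hu]
      simp only [map_sum, map_smul, hx2]
      simp [P, mul_comm]
    rw [← this]
    exact hx1.hasFDerivAt
  have h2 : HasFDerivAt (fun x => ∑ ν, d ν x • P ν) (∑ ν, (d' ν).smulRight (P ν)) x₀ :=
    HasFDerivAt.fun_sum fun ν _ => (hd' ν).smul_const (P ν)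
  have h3 := second_derivative_symmetric_of_eventually h1 h2 (Pi.single η 1) (Pi.single μ 1)
  simpa [P, Pi.single_apply] using h3

end sopde

/-- The second-order system of PDEs `∂²fᴬ/∂x^ρ∂x^ν = Gᴬ_{ρν}(x, f, Df)` defined by a SOPDE
jet field on the jet bundle of the trivial bundle `ℝᵐ × ℝᴺ → ℝᵐ` admits local solutions with
arbitrary initial data if and only if the symmetry and vanishing-curvature conditions hold
identically. -/
theorem sopde_integrable_iff_curvature_zero (m N : ℕ)
    (G : Fin N → Fin m → Fin m →
      ((Fin m → ℝ) × (Fin N → ℝ) × (Fin N → Fin m → ℝ)) → ℝ)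
    (hG : ∀ A ρ ν, ContDiff ℝ (⊤ : ℕ∞) (G A ρ ν)) :
    (∀ (x₀ : Fin m → ℝ) (y₀ : Fin N → ℝ) (v₀ : Fin N → Fin m → ℝ),
      ∃ U : Set (Fin m → ℝ), IsOpen U ∧ x₀ ∈ U ∧
        ∃ f : (Fin m → ℝ) → (Fin N → ℝ), ContDiffOn ℝ 2 f U ∧ f x₀ = y₀ ∧
          (∀ (A : Fin N) (μ : Fin m),
            fderiv ℝ (fun x => f x A) x₀ (Pi.single μ 1) = v₀ A μ) ∧
          ∀ x ∈ U, ∀ (A : Fin N) (ρ ν : Fin m),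
            fderiv ℝ (fun x' => fderiv ℝ (fun x'' => f x'' A) x' (Pi.single ν 1)) x
                (Pi.single ρ 1)
              = G A ρ ν (x, f x, fun B μ => fderiv ℝ (fun x'' => f x'' B) x (Pi.single μ 1)))
    ↔
    (∀ (p : (Fin m → ℝ) × (Fin N → ℝ) × (Fin N → Fin m → ℝ))
        (B : Fin N) (μ η ρ : Fin m),
      G B η μ p - G B μ η p = 0 ∧
      fderiv ℝ (G B η ρ) p (Pi.single μ 1, 0, 0)
        + ∑ A : Fin N, p.2.2 A μ * fderiv ℝ (G B η ρ) p (0, Pi.single A 1, 0)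
        + ∑ A : Fin N, ∑ γ : Fin m, G A μ γ p *
            fderiv ℝ (G B η ρ) p (0, 0, Pi.single A (Pi.single γ 1))
        - fderiv ℝ (G B μ ρ) p (Pi.single η 1, 0, 0)
        - ∑ A : Fin N, p.2.2 A η * fderiv ℝ (G B μ ρ) p (0, Pi.single A 1, 0)
        - ∑ A : Fin N, ∑ γ : Fin m, G A η γ p *
            fderiv ℝ (G B μ ρ) p (0, 0, Pi.single A (Pi.single γ 1)) = 0) := by
  constructor
  · intro H p
    obtain ⟨x₀, y₀, v₀⟩ := p
    obtain ⟨U, hU, hxU, f, hf, hf0, hv0, hpde⟩ := H x₀ y₀ v₀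
    set Φ : (Fin m → ℝ) → (Fin m → ℝ) × (Fin N → ℝ) × (Fin N → Fin m → ℝ) := fun x =>
      (x, f x, fun B μ => fderiv ℝ (fun x'' => f x'' B) x (Pi.single μ 1)) with hΦ
    have hΦ0 : Φ x₀ = (x₀, y₀, v₀) := by
      simp only [hΦ, hf0]
      congr 2
      funext B μ
      exact hv0 B μ
    have hfA : ∀ A, ContDiffOn ℝ 2 (fun x => f x A) U := fun A => contDiffOn_pi.1 hf A
    have hdA : ∀ A, ContDiffOn ℝ 1 (fderiv ℝ (fun x => f x A)) U := fun A =>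
      (hfA A).fderiv_of_isOpen hU (by norm_num)
    have hdd : ∀ A ν, ∀ x ∈ U, DifferentiableAt ℝ
        (fun x => fderiv ℝ (fun x => f x A) x (Pi.single ν 1)) x := fun A ν x hx =>
      (((hdA A).differentiableOn (by simp)).differentiableAt (hU.mem_nhds hx)).clm_apply
        (differentiableAt_const _)
    have hUn := hU.mem_nhds hxU
    have hfd : ∀ A, ∀ x ∈ U, DifferentiableAt ℝ (fun x => f x A) x := fun A x hx =>
      ((hfA A).differentiableOn (by simp)).differentiableAt (hU.mem_nhds hx)
    have hsym : ∀ B μ η, G B η μ (x₀, y₀, v₀) = G B μ η (x₀, y₀, v₀) := by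
      intro B μ η
      have h := sym_partial (fun x => f x B)
        (fun ν x => fderiv ℝ (fun x => f x B) x (Pi.single ν 1)) x₀
        (by filter_upwards [hUn] with x hx using hfd B x hx)
        (by filter_upwards with x ν using rfl) _
        (fun ν => (hdd B ν x₀ hxU).hasFDerivAt) μ η
      rw [hpde x₀ hxU, hpde x₀ hxU] at h
      have h' : G B η μ (Φ x₀) = G B μ η (Φ x₀) := h
      rwa [hΦ0] at h'
    obtain ⟨Φ', hΦ', hΦs⟩ : ∃ Φ', HasFDerivAt Φ Φ' x₀ ∧
        ∀ μ, Φ' (Pi.single μ 1) = (Pi.single μ 1, jetG G μ (x₀, y₀, v₀)) := by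
      have e1 : HasFDerivAt f _ x₀ := hasFDerivAt_pi.2 fun A => (hfd A x₀ hxU).hasFDerivAt
      have e2 : HasFDerivAt
          (fun x => fun B μ => fderiv ℝ (fun x'' => f x'' B) x (Pi.single μ 1)) _ x₀ :=
        hasFDerivAt_pi.2 fun A => hasFDerivAt_pi.2 fun ν => (hdd A ν x₀ hxU).hasFDerivAt
      refine ⟨_, (hasFDerivAt_id x₀).prodMk (e1.prodMk e2), fun μ => ?_⟩
      refine Prod.ext ?_ (Prod.ext ?_ ?_)
      · simp
      · funext A
        simpa [jetG] using hv0 A μ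
      · funext A ν
        have := hpde x₀ hxU A μ ν
        change _ = G A μ ν (Φ x₀) at this
        rw [hΦ0] at this
        simpa [jetG] using this
    intro B μ η ρ
    refine ⟨sub_eq_zero.2 (hsym B μ η), ?_⟩
    have h := sym_partial (fun x => fderiv ℝ (fun x => f x B) x (Pi.single ρ 1))
      (fun ν x => G B ν ρ (Φ x)) x₀
      (by filter_upwards [hUn] with x hx using hdd B ρ x hx)
      (by filter_upwards [hUn] with x hx ν using hpde x hx B ν ρ)
      (fun ν => (fderiv ℝ (G B ν ρ) (x₀, y₀, v₀)).comp Φ')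
      (fun ν => by
        have h1 := ((hG B ν ρ).differentiable (by simp) (Φ x₀)).hasFDerivAt.comp x₀ hΦ'
        rw [hΦ0] at h1
        exact h1) η μ
    simp only [ContinuousLinearMap.comp_apply, hΦs] at h
    rw [total_deriv, total_deriv] at h
    linarith
  · intro H x₀ y₀ v₀
    have hs : ∀ p B μ η, G B η μ p = G B μ η p := fun p B μ η =>
      sub_eq_zero.1 (H p B μ η η).1
    have hc : ∀ p B μ η ρ, fderiv ℝ (G B η ρ) p (Pi.single μ 1, jetG G μ p)
        = fderiv ℝ (G B μ ρ) p (Pi.single η 1, jetG G η p) := by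
      intro p B μ η ρ
      have h := (H p B μ η ρ).2
      rw [total_deriv, total_deriv]
      linarith
    obtain ⟨z, hz0, ε, hε, hz⟩ := frob_local (jetF G) (jetF_contDiff G hG) x₀ (y₀, v₀)
      (jetF_integrable G hG hs hc)
    have hz2 := frob_contDiffOn (jetF G) (jetF_contDiff G hG) z (ball x₀ ε) isOpen_ball hz
    have hf1 : ∀ x ∈ ball x₀ ε, ∀ A μ,
        fderiv ℝ (fun x => (z x).1 A) x (Pi.single μ 1) = (z x).2 A μ := by
      intro x hx A μ
      have h := hasFDerivAt_pi'.1 (hz x hx).fst A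
      rw [h.fderiv]
      simp [jetF_single, jetG]
    refine ⟨ball x₀ ε, isOpen_ball, mem_ball_self hε, fun x => (z x).1,
      contDiff_fst.comp_contDiffOn hz2, by simp [hz0], ?_, ?_⟩
    · intro A μ
      rw [hf1 x₀ (mem_ball_self hε), hz0]
    · intro x hx A ρ ν
      have hev : (fun x' => fderiv ℝ (fun x'' => (z x'').1 A) x' (Pi.single ν 1))
          =ᶠ[𝓝 x] fun x' => (z x').2 A ν := by
        filter_upwards [isOpen_ball.mem_nhds hx] with x' hx' using hf1 x' hx' A ν
      have h := hasFDerivAt_pi'.1 (hasFDerivAt_pi'.1 (hz x hx).snd A) ν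
      rw [hev.fderiv_eq, h.fderiv]
      simp only [hf1 x hx]
      simp [jetF_single, jetG]
end

section
/- Let N ≥ 1 and let f : ℝᴺ → ℝ be real-analytic. On ℝ^{2+3N} with coordinates (x⁰, x¹, yᴬ, vᴬ₀, vᴬ₁) (A = 1,…,N), define, for given functions G^B_{00}, G^B_{01}, the abbreviations G^B_{10} := G^B_{01}, G^B_{11} := ∂f/∂yᴮ − G^B_{00}, and the first-order differential operators X_μ = ∂/∂xᵘ + Σ_A vᴬ_μ ∂/∂yᴬ + Σ_{A,ρ} Gᴬ_{μρ} ∂/∂vᴬ_ρ for μ, ρ ∈ {0,1}. Then for every point p ∈ ℝ^{2+3N} there exist an open neighborhood W of p and real-analytic functions G^B_{00}, G^B_{01} : W → ℝ (B = 1,…,N) satisfying on W, for every B: 0 = X₀(G^B_{10}) − X₁(G^B_{00}) and 0 = X₀(G^B_{00}) − Σ_A vᴬ₀ ∂²f/∂yᴬ∂yᴮ − X₁(G^B_{01}). -/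
/-- The full family `Gᴬ_{μρ}` (for `μ, ρ ∈ {0,1}`) built from the unknowns `G_{00}`, `G_{01}`
via the abbreviations `G_{10} := G_{01}` and `G_{11} := ∂f/∂y − G_{00}` coming from the
Euler–Lagrange relation of the Lagrangian `L = ½ Σ (vᴬ_μ)² + f(y)`. -/
noncomputable def jetExampleG (N : ℕ) (f : (Fin N → ℝ) → ℝ)
    (G00 G01 : Fin N → ((Fin 2 → ℝ) × (Fin N → ℝ) × (Fin N → Fin 2 → ℝ)) → ℝ) :
    Fin N → Fin 2 → Fin 2 →
      ((Fin 2 → ℝ) × (Fin N → ℝ) × (Fin N → Fin 2 → ℝ)) → ℝ :=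
  fun B μ ρ =>
    if μ = 0 then (if ρ = 0 then G00 B else G01 B)
    else (if ρ = 0 then G01 B
      else fun q => fderiv ℝ f q.2.1 (Pi.single B 1) - G00 B q)

/-- The vector field `X_μ = ∂/∂xᵘ + Σ_A vᴬ_μ ∂/∂yᴬ + Σ_{A,ρ} Gᴬ_{μρ} ∂/∂vᴬ_ρ` on the jet
space `ℝ^{2+3N}`, as a map assigning to each point its value as a tangent vector. -/
noncomputable def jetExampleX (N : ℕ) (f : (Fin N → ℝ) → ℝ)
    (G00 G01 : Fin N → ((Fin 2 → ℝ) × (Fin N → ℝ) × (Fin N → Fin 2 → ℝ)) → ℝ)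
    (μ : Fin 2) (p : (Fin 2 → ℝ) × (Fin N → ℝ) × (Fin N → Fin 2 → ℝ)) :
    (Fin 2 → ℝ) × (Fin N → ℝ) × (Fin N → Fin 2 → ℝ) :=
  (Pi.single μ 1, fun A => p.2.2 A μ, fun A ρ => jetExampleG N f G00 G01 A μ ρ p)

open scoped ENNReal NNReal Topology

namespace CKaux

set_option linter.unusedSectionVars false

/-- The Banach space `ℓ¹(I)`. -/
abbrev L1 (I : Type) := lp (fun _ : I => ℝ) 1

section ell
variable {I : Type} {F : Type*} [NormedAddCommGroup F] [NormedSpace ℝ F]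

open Classical in
/-- basis vectors of `ℓ¹(I)` -/
noncomputable def bs (i : I) : L1 I := lp.single 1 i (1 : ℝ)

lemma hasSum_norm (f : L1 I) : HasSum (fun i => ‖f i‖) ‖f‖ := by
  have := lp.hasSum_norm (p := 1) (by norm_num) f
  simpa using this

lemma hasSum_bs (f : L1 I) : HasSum (fun i => f i • bs i) f := by
  classical
  have := lp.hasSum_single (p := 1) (by norm_num) f
  convert this using 2 with i
  rw [bs, ← lp.single_smul, smul_eq_mul, mul_one]

lemma norm_bs (i : I) : ‖bs i‖ = 1 := by
  classical
  rw [bs, lp.norm_single (by norm_num)]; simp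

lemma bs_apply_self (i : I) : bs i i = 1 := by
  classical
  rw [bs, lp.single_apply_self]

lemma bs_apply_ne {i j : I} (h : j ≠ i) : bs i j = 0 := by
  classical
  rw [bs, lp.single_apply_ne _ _ _ h]

lemma exists_lift [CompleteSpace F] (b : I → F) (C : ℝ) (hb : ∀ i, ‖b i‖ ≤ C) :
    ∃ T : L1 I →L[ℝ] F, (∀ i, T (bs i) = b i) ∧ ∀ f, ‖T f‖ ≤ C * ‖f‖ := by
  have hs : ∀ f : L1 I, Summable (fun i => f i • b i) := fun f => by
    refine Summable.of_norm_bounded ((hasSum_norm f).summable.mul_left C) fun i => ?_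
    rw [norm_smul, mul_comm]
    exact mul_le_mul_of_nonneg_right (hb i) (norm_nonneg _)
  have hbd : ∀ f : L1 I, ‖∑' i, f i • b i‖ ≤ C * ‖f‖ := fun f => by
    refine tsum_of_norm_bounded ((hasSum_norm f).mul_left C) fun i => ?_
    rw [norm_smul, mul_comm]
    exact mul_le_mul_of_nonneg_right (hb i) (norm_nonneg _)
  let T0 : L1 I →ₗ[ℝ] F :=
    { toFun := fun f => ∑' i, f i • b i
      map_add' := fun f g => by
        rw [← (hs f).tsum_add (hs g)]
        exact tsum_congr fun i => by rw [lp.coeFn_add, Pi.add_apply, add_smul]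
      map_smul' := fun c f => by
        rw [RingHom.id_apply, ← (hs f).tsum_const_smul]
        exact tsum_congr fun i => by
          rw [lp.coeFn_smul, Pi.smul_apply, smul_eq_mul, mul_smul] }
  refine ⟨T0.mkContinuous C hbd, fun i => ?_, fun f => hbd f⟩
  change ∑' k, bs i k • b k = b i
  rw [tsum_eq_single i, bs_apply_self, one_smul]
  intro k hk
  rw [bs_apply_ne hk, zero_smul]

lemma clm_ext {S T : L1 I →L[ℝ] F} (h : ∀ i, S (bs i) = T (bs i)) : S = T := by
  ext f
  have h1 := (hasSum_bs f).mapL S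
  have h2 := (hasSum_bs f).mapL T
  simp only [map_smul, h] at h1 h2
  exact h1.unique h2

end ell

section ck
variable {ι : Type} [Fintype ι] [DecidableEq ι]

/-- total degree -/
def deg (α : ι → ℕ) : ℕ := ∑ j, α j

lemma deg_add (α β : ι → ℕ) : deg (α + β) = deg α + deg β := by
  simp [deg, Finset.sum_add_distrib]

lemma deg_single (j : ι) : deg (Pi.single j 1 : ι → ℕ) = 1 := by
  simp [deg]

lemma single_le {α : ι → ℕ} {j : ι} (h : α j ≠ 0) : (Pi.single j 1 : ι → ℕ) ≤ α := by
  intro l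
  by_cases hl : l = j
  · subst hl; simp; omega
  · simp [hl]

lemma le_deg (α : ι → ℕ) (j : ι) : α j ≤ deg α :=
  Finset.single_le_sum (f := α) (fun _ _ => Nat.zero_le _) (Finset.mem_univ j)

lemma choose_mul_le (a b k l : ℕ) :
    a.choose k * b.choose l ≤ (a + b).choose (k + l) := by
  rw [Nat.add_choose_eq]
  exact Finset.single_le_sum (f := fun ij : ℕ × ℕ => a.choose ij.1 * b.choose ij.2)
    (fun _ _ => Nat.zero_le _) (a := (k, l)) (by simp)

/-- structure constants of the bilinear operator `(a, b) ↦ ∫ a ∂_j b dt` -/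
noncomputable def coef (j : ι) (i i' : ℕ × (ι → ℕ)) : ℝ :=
  ((deg i.2 + i.1).choose i.1 : ℝ) * ((deg i'.2 + i'.1).choose i'.1 : ℝ) * i'.2 j /
    ((i.1 + i'.1 + 1 : ℝ) *
      ((deg i.2 + i.1 + (deg i'.2 + i'.1)).choose (i.1 + i'.1 + 1) : ℝ))

lemma coef_nonneg (j : ι) (i i' : ℕ × (ι → ℕ)) : 0 ≤ coef j i i' := by
  unfold coef; positivity

lemma coef_le (j : ι) (i i' : ℕ × (ι → ℕ)) : coef j i i' ≤ 1 := by
  unfold coef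
  refine div_le_one_of_le₀ ?_ (by positivity)
  have h1 := choose_mul_le (deg i.2 + i.1) (deg i'.2 + i'.1) i.1 i'.1
  have h2 := Nat.choose_succ_right_eq (deg i.2 + i.1 + (deg i'.2 + i'.1)) (i.1 + i'.1)
  have h3 : deg i.2 + i.1 + (deg i'.2 + i'.1) - (i.1 + i'.1) = deg i.2 + deg i'.2 := by omega
  rw [h3] at h2
  have h4 := le_deg i'.2 j
  have h5 : (deg i.2 + i.1).choose i.1 * (deg i'.2 + i'.1).choose i'.1 * i'.2 j ≤
     (i.1 + i'.1 + 1) * (deg i.2 + i.1 + (deg i'.2 + i'.1)).choose (i.1 + i'.1 + 1) := by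
    rw [mul_comm (i.1 + i'.1 + 1), h2]
    exact Nat.mul_le_mul h1 (by omega)
  exact_mod_cast h5

lemma exists_D (j : ι) : ∃ D : L1 (ℕ × (ι → ℕ)) →L[ℝ] L1 (ℕ × (ι → ℕ)) →L[ℝ] L1 (ℕ × (ι → ℕ)),
    ∀ i i', D (bs i) (bs i') =
      coef j i i' • bs (i.1 + i'.1 + 1, i.2 + i'.2 - Pi.single j 1) := by
  have h1 : ∀ i : ℕ × (ι → ℕ), ∃ T : L1 (ℕ × (ι → ℕ)) →L[ℝ] L1 (ℕ × (ι → ℕ)),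
      (∀ i', T (bs i') = coef j i i' • bs (i.1 + i'.1 + 1, i.2 + i'.2 - Pi.single j 1)) ∧
      ∀ f, ‖T f‖ ≤ 1 * ‖f‖ := fun i => by
    refine exists_lift _ 1 fun i' => ?_
    rw [norm_smul, norm_bs, mul_one, Real.norm_of_nonneg (coef_nonneg _ _ _)]
    exact coef_le j i i'
  choose T hT hT' using h1
  obtain ⟨D, hD, -⟩ := exists_lift T 1
    (fun i => ContinuousLinearMap.opNorm_le_bound _ zero_le_one (hT' i))
  exact ⟨D, fun i i' => by rw [hD, hT]⟩

variable {V : Type*} [NormedAddCommGroup V] [NormedSpace ℝ V]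

/-- weighted monomials -/
noncomputable def mono (τ : V →L[ℝ] ℝ) (ξ : ι → V →L[ℝ] ℝ) (i : ℕ × (ι → ℕ)) (v : V) : ℝ :=
  ((deg i.2 + i.1).choose i.1 : ℝ) * (τ v ^ i.1 * ∏ j, ξ j v ^ i.2 j)

lemma exists_mult (τ : V →L[ℝ] ℝ) (ξ : ι → V →L[ℝ] ℝ) (K : ℝ) (hτ : ‖τ‖ ≤ K)
    (hξ : ∀ j, ‖ξ j‖ ≤ K) (i : ℕ × (ι → ℕ)) (n : ℕ) (hn : deg i.2 + i.1 = n) :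
    ∃ M : ContinuousMultilinearMap ℝ (fun _ : Fin n => V) ℝ, ‖M‖ ≤ (2 * K) ^ n ∧
      ∀ v, M (fun _ => v) = mono τ ξ i v := by
  classical
  let s : Multiset (V →L[ℝ] ℝ) :=
    Multiset.replicate i.1 τ + ∑ j, Multiset.replicate (i.2 j) (ξ j)
  have hs : s.toList.length = n := by
    simp [s, ← hn, deg, add_comm]
  have hsK : ∀ l ∈ s.toList, ‖l‖ ≤ K := by
    intro l hl
    simp only [Multiset.mem_toList, s, Multiset.mem_add, Multiset.mem_sum] at hl
    rcases hl with hl | ⟨j, -, hl⟩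
    · rw [Multiset.eq_of_mem_replicate hl]; exact hτ
    · rw [Multiset.eq_of_mem_replicate hl]; exact hξ j
  subst hs
  refine ⟨((deg i.2 + i.1).choose i.1 : ℝ) •
    (ContinuousMultilinearMap.mkPiAlgebraFin ℝ s.toList.length ℝ).compContinuousLinearMap
      (fun k => s.toList.get k), ?_, fun v => ?_⟩
  · rw [norm_smul, mul_pow]
    refine mul_le_mul ?_ ?_ (norm_nonneg _) (by positivity)
    · rw [← hn]
      simp only [Real.norm_natCast]
      exact_mod_cast Nat.choose_le_two_pow _ _
    · refine (ContinuousMultilinearMap.norm_compContinuousLinearMap_le _ _).trans ?_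
      rw [ContinuousMultilinearMap.norm_mkPiAlgebraFin, one_mul]
      refine (Finset.prod_le_prod (fun _ _ => norm_nonneg _)
        (fun k _ => hsK _ (List.get_mem _ k))).trans ?_
      simp
  · have : (List.ofFn fun k => (s.toList.get k) v).prod = (s.map (fun l => l v)).prod := by
      have h := List.map_ofFn (f := s.toList.get) (g := fun l : V →L[ℝ] ℝ => l v)
      rw [List.ofFn_get] at h
      change (List.ofFn ((fun l : V →L[ℝ] ℝ => l v) ∘ s.toList.get)).prod = _
      rw [← h, ← Multiset.prod_coe, ← Multiset.map_coe, Multiset.coe_toList]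
    simp only [_root_.smul_apply,
      ContinuousMultilinearMap.compContinuousLinearMap_apply,
      ContinuousMultilinearMap.mkPiAlgebraFin_apply, smul_eq_mul, mono]
    rw [this]
    congr 1
    have h2 : Multiset.map (fun l : V →L[ℝ] ℝ => l v)
        (∑ j, Multiset.replicate (i.2 j) (ξ j)) =
        ∑ j, Multiset.replicate (i.2 j) (ξ j v) := by
      have := map_sum (Multiset.mapAddMonoidHom (fun l : V →L[ℝ] ℝ => l v))
        (fun j => Multiset.replicate (i.2 j) (ξ j)) Finset.univ
      refine this.trans ?_
      simp
    simp only [s, Multiset.map_add, Multiset.prod_add, h2, Multiset.map_replicate,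
      Multiset.prod_replicate, Multiset.prod_sum]

lemma exists_ev (τ : V →L[ℝ] ℝ) (ξ : ι → V →L[ℝ] ℝ) :
    ∃ R : ℝ, 0 < R ∧ ∃ ev : V → (L1 (ℕ × (ι → ℕ)) →L[ℝ] ℝ),
      AnalyticOnNhd ℝ ev (Metric.ball 0 R) ∧
      ∀ v ∈ Metric.ball (0 : V) R, ∀ i, ev v (bs i) = mono τ ξ i v := by
  classical
  obtain ⟨K, hK0, hτ, hξ⟩ : ∃ K : ℝ, 0 < K ∧ ‖τ‖ ≤ K ∧ ∀ j, ‖ξ j‖ ≤ K := by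
    refine ⟨1 + ‖τ‖ + ∑ j, ‖ξ j‖, by positivity, ?_, fun j => ?_⟩
    · have : 0 ≤ ∑ j, ‖ξ j‖ := by positivity
      linarith
    · have := Finset.single_le_sum (f := fun j => ‖ξ j‖) (fun _ _ => norm_nonneg _)
        (Finset.mem_univ j)
      have h := norm_nonneg τ
      linarith
  have h1 : ∀ n : ℕ, ∀ i : ℕ × (ι → ℕ),
      ∃ M : ContinuousMultilinearMap ℝ (fun _ : Fin n => V) ℝ, ‖M‖ ≤ (2 * K) ^ n ∧
      ∀ v, M (fun _ => v) = if deg i.2 + i.1 = n then mono τ ξ i v else 0 := by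
    intro n i
    by_cases h : deg i.2 + i.1 = n
    · simpa [h] using exists_mult τ ξ K hτ hξ i n h
    · exact ⟨0, by rw [norm_zero]; positivity, by simp [h]⟩
  choose M hM hMv using h1
  have h2 : ∀ n, _ := fun n => exists_lift (M n) _ (hM n)
  choose T hT hT' using h2
  let p : FormalMultilinearSeries ℝ V (L1 (ℕ × (ι → ℕ)) →L[ℝ] ℝ) :=
    fun n => (T n).flipMultilinear
  have hpn : ∀ n, ‖p n‖ ≤ (2 * K) ^ n := by
    intro n
    refine ContinuousMultilinearMap.opNorm_le_bound (by positivity) fun m => ?_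
    refine ContinuousLinearMap.opNorm_le_bound _ (by positivity) fun f => ?_
    change ‖T n f m‖ ≤ _
    refine ((T n f).le_opNorm m).trans ?_
    have := mul_le_mul_of_nonneg_right (hT' n f)
      (show 0 ≤ ∏ i, ‖m i‖ by positivity)
    linarith
  let R : ℝ≥0 := ⟨(2 * K)⁻¹, by positivity⟩
  have hR : 0 < (R : ℝ) := by change 0 < (2 * K)⁻¹; positivity
  have hrad : (R : ℝ≥0∞) ≤ p.radius := by
    refine p.le_radius_of_bound 1 fun n => ?_
    change ‖p n‖ * ((2 * K)⁻¹) ^ n ≤ 1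
    rw [inv_pow, ← div_eq_mul_inv]
    exact div_le_one_of_le₀ (hpn n) (by positivity)
  have hR' : (0 : ℝ≥0∞) < R := by exact_mod_cast hR
  have hp := (p.hasFPowerSeriesOnBall (hR'.trans_le hrad)).mono hR' hrad
  refine ⟨R, hR, p.sum, ?_, ?_⟩
  · have := hp.analyticOnNhd
    rwa [Metric.eball_coe] at this
  · intro v hv i
    have hs := hp.hasSum (y := v) (by rwa [Metric.eball_coe])
    rw [zero_add] at hs
    have hs2 := hs.mapL (ContinuousLinearMap.apply ℝ ℝ (bs i))
    refine hs2.unique ?_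
    have : (fun n => ContinuousLinearMap.apply ℝ ℝ (bs i) (p n fun _ => v)) =
        fun n => if n = deg i.2 + i.1 then mono τ ξ i v else 0 := by
      funext n
      change T n (bs i) (fun _ => v) = _
      rw [hT, hMv]
      simp [eq_comm]
    rw [this]
    exact hasSum_ite_eq _ _

lemma hasDerivAt_mono_t (τ : V →L[ℝ] ℝ) (ξ : ι → V →L[ℝ] ℝ) (i : ℕ × (ι → ℕ)) (v e : V)
    (h1 : τ e = 1) (h2 : ∀ j, ξ j e = 0) :
    HasDerivAt (fun s : ℝ => mono τ ξ i (v + s • e))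
      (((deg i.2 + i.1).choose i.1 : ℝ) * ((i.1 * τ v ^ (i.1 - 1)) * ∏ j, ξ j v ^ i.2 j)) 0 := by
  have h : HasDerivAt (fun s : ℝ => (τ v + s) ^ i.1) (i.1 * τ v ^ (i.1 - 1)) 0 := by
    exact (((hasDerivAt_id (0 : ℝ)).const_add (τ v)).fun_pow i.1).congr_deriv (by simp)
  have := (h.mul_const (∏ j, ξ j v ^ i.2 j)).const_mul ((deg i.2 + i.1).choose i.1 : ℝ)
  refine this.congr_of_eventuallyEq (Filter.Eventually.of_forall fun s => ?_)
  simp [mono, h1, h2]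

lemma hasDerivAt_mono_x (τ : V →L[ℝ] ℝ) (ξ : ι → V →L[ℝ] ℝ) (i : ℕ × (ι → ℕ)) (v e : V) (j : ι)
    (h1 : τ e = 0) (h2 : ξ j e = 1) (h3 : ∀ l, l ≠ j → ξ l e = 0) :
    HasDerivAt (fun s : ℝ => mono τ ξ i (v + s • e))
      (((deg i.2 + i.1).choose i.1 : ℝ) * (τ v ^ i.1 * ((i.2 j * ξ j v ^ (i.2 j - 1)) *
        ∏ l ∈ Finset.univ.erase j, ξ l v ^ i.2 l))) 0 := by
  have h : HasDerivAt (fun s : ℝ => (ξ j v + s) ^ i.2 j) (i.2 j * ξ j v ^ (i.2 j - 1)) 0 := by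
    exact (((hasDerivAt_id (0 : ℝ)).const_add (ξ j v)).fun_pow (i.2 j)).congr_deriv (by simp)
  have := ((h.mul_const (∏ l ∈ Finset.univ.erase j, ξ l v ^ i.2 l)).const_mul
    (τ v ^ i.1)).const_mul ((deg i.2 + i.1).choose i.1 : ℝ)
  refine this.congr_of_eventuallyEq (Filter.Eventually.of_forall fun s => ?_)
  have hp : ∏ l ∈ Finset.univ.erase j, (ξ l v + s * ξ l e) ^ i.2 l =
      ∏ l ∈ Finset.univ.erase j, ξ l v ^ i.2 l :=
    Finset.prod_congr rfl fun l hl => by rw [h3 l (Finset.ne_of_mem_erase hl), mul_zero, add_zero]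
  simp only [mono, map_add, map_smul, smul_eq_mul, h1, mul_zero, add_zero]
  rw [← Finset.mul_prod_erase Finset.univ _ (Finset.mem_univ j), hp, h2, mul_one]

lemma mono_identity (τ : V →L[ℝ] ℝ) (ξ : ι → V →L[ℝ] ℝ) (i i' : ℕ × (ι → ℕ)) (v : V) (j : ι) :
    coef j i i' * (((deg (i.2 + i'.2 - Pi.single j 1) + (i.1 + i'.1 + 1)).choose
        (i.1 + i'.1 + 1) : ℝ) *
      ((((i.1 + i'.1 + 1 : ℕ) : ℝ) * τ v ^ ((i.1 + i'.1 + 1) - 1)) *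
        ∏ l, ξ l v ^ (i.2 + i'.2 - Pi.single j 1 : ι → ℕ) l)) =
    mono τ ξ i v * (((deg i'.2 + i'.1).choose i'.1 : ℝ) *
      (τ v ^ i'.1 * ((i'.2 j * ξ j v ^ (i'.2 j - 1)) *
        ∏ l ∈ Finset.univ.erase j, ξ l v ^ i'.2 l))) := by
  by_cases h0 : i'.2 j = 0
  · simp [coef, h0]
  have hd : deg (i.2 + i'.2 - Pi.single j 1) + (i.1 + i'.1 + 1) =
      deg i.2 + i.1 + (deg i'.2 + i'.1) := by
    have h := deg_add (i.2 + i'.2 - Pi.single j 1) (Pi.single j 1)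
    rw [tsub_add_cancel_of_le, deg_single, deg_add] at h
    · omega
    · exact single_le (by simp [h0])
  have hpos : 0 < ((deg i.2 + i.1 + (deg i'.2 + i'.1)).choose (i.1 + i'.1 + 1) : ℝ) := by
    have : 0 < (deg i.2 + i.1 + (deg i'.2 + i'.1)).choose (i.1 + i'.1 + 1) :=
      Nat.choose_pos (by omega)
    exact_mod_cast this
  have hprod : ∏ l, ξ l v ^ (i.2 + i'.2 - Pi.single j 1 : ι → ℕ) l =
      (∏ l, ξ l v ^ i.2 l) * (ξ j v ^ (i'.2 j - 1) *
        ∏ l ∈ Finset.univ.erase j, ξ l v ^ i'.2 l) := by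
    rw [← Finset.mul_prod_erase Finset.univ _ (Finset.mem_univ j),
      ← Finset.mul_prod_erase Finset.univ (fun l => ξ l v ^ i.2 l) (Finset.mem_univ j)]
    have hp : ∏ l ∈ Finset.univ.erase j, ξ l v ^ (i.2 + i'.2 - Pi.single j 1 : ι → ℕ) l =
        (∏ l ∈ Finset.univ.erase j, ξ l v ^ i.2 l) *
          ∏ l ∈ Finset.univ.erase j, ξ l v ^ i'.2 l := by
      rw [← Finset.prod_mul_distrib]
      refine Finset.prod_congr rfl fun l hl => ?_
      rw [← pow_add]
      simp [Finset.ne_of_mem_erase hl]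
    have hj : (i.2 + i'.2 - Pi.single j 1 : ι → ℕ) j = i.2 j + (i'.2 j - 1) := by
      simp; omega
    rw [hp, hj, pow_add]
    ring
  rw [hd, hprod, coef, mono, Nat.add_sub_cancel, pow_add]
  push_cast
  have hk : (0 : ℝ) < i.1 + i'.1 + 1 := by positivity
  field_simp

/-- fundamental identity `∂_t (D_j (a, b)) = a ∂_j b` -/
lemma D_identity (τ : V →L[ℝ] ℝ) (ξ : ι → V →L[ℝ] ℝ) {U : Set V} (hU : IsOpen U)
    {ev : V → (L1 (ℕ × (ι → ℕ)) →L[ℝ] ℝ)} (hev : DifferentiableOn ℝ ev U)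
    (hm : ∀ v ∈ U, ∀ i, ev v (bs i) = mono τ ξ i v) (j : ι)
    {D : L1 (ℕ × (ι → ℕ)) →L[ℝ] L1 (ℕ × (ι → ℕ)) →L[ℝ] L1 (ℕ × (ι → ℕ))}
    (hD : ∀ i i', D (bs i) (bs i') =
      coef j i i' • bs (i.1 + i'.1 + 1, i.2 + i'.2 - Pi.single j 1))
    {et ej : V} (ht1 : τ et = 1) (ht2 : ∀ l, ξ l et = 0)
    (h1 : τ ej = 0) (h2 : ξ j ej = 1) (h3 : ∀ l, l ≠ j → ξ l ej = 0)
    {v : V} (hv : v ∈ U) (a b : L1 (ℕ × (ι → ℕ))) :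
    fderiv ℝ ev v et (D a b) = ev v a * fderiv ℝ ev v ej b := by
  have key : ∀ (e : V) (i : ℕ × (ι → ℕ)) (d : ℝ),
      HasDerivAt (fun s : ℝ => mono τ ξ i (v + s • e)) d 0 → fderiv ℝ ev v e (bs i) = d := by
    intro e i d hd
    have hdv : HasFDerivAt ev (fderiv ℝ ev v) (v + (0 : ℝ) • e) := by
      rw [zero_smul, add_zero]
      exact (hev.differentiableAt (hU.mem_nhds hv)).hasFDerivAt
    have hl : HasDerivAt (fun s : ℝ => v + s • e) e 0 := by
      simpa using ((hasDerivAt_id (0 : ℝ)).smul_const e).const_add v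
    have hc := hdv.comp_hasDerivAt (0 : ℝ) hl
    have hc2 := ((ContinuousLinearMap.apply ℝ ℝ (bs i)).hasFDerivAt).comp_hasDerivAt (0 : ℝ) hc
    have hev0 : (fun s : ℝ => mono τ ξ i (v + s • e)) =ᶠ[𝓝 0]
        ((ContinuousLinearMap.apply ℝ ℝ (bs i)) ∘ (ev ∘ fun s : ℝ => v + s • e)) := by
      have : ∀ᶠ s : ℝ in 𝓝 0, v + s • e ∈ U := by
        refine hl.continuousAt.eventually_mem ?_
        simpa using hU.mem_nhds hv
      filter_upwards [this] with s hs
      exact (hm _ hs i).symm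
    exact (hc2.congr_of_eventuallyEq hev0).unique hd
  have s1 : ∀ i b, fderiv ℝ ev v et (D (bs i) b) = ev v (bs i) * fderiv ℝ ev v ej b := by
    intro i b
    have : (fderiv ℝ ev v et) ∘L D (bs i) = (ev v (bs i)) • fderiv ℝ ev v ej := by
      refine clm_ext fun i' => ?_
      rw [ContinuousLinearMap.comp_apply, hD, map_smul, smul_eq_mul, _root_.smul_apply,
        smul_eq_mul, hm v hv,
        key _ _ _ (hasDerivAt_mono_t τ ξ _ v et ht1 ht2),
        key _ _ _ (hasDerivAt_mono_x τ ξ _ v ej j h1 h2 h3)]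
      exact mono_identity τ ξ i i' v j
    exact DFunLike.congr_fun this b
  have : (fderiv ℝ ev v et) ∘L (D.flip b) = (fderiv ℝ ev v ej b) • ev v := by
    refine clm_ext fun i => ?_
    rw [ContinuousLinearMap.comp_apply, ContinuousLinearMap.flip_apply, s1, _root_.smul_apply,
      smul_eq_mul, mul_comm]
  have h := DFunLike.congr_fun this a
  rw [ContinuousLinearMap.comp_apply, ContinuousLinearMap.flip_apply, _root_.smul_apply,
    smul_eq_mul, mul_comm] at h
  exact h

end ck

/-- small-parameter fixed points -/
lemma exists_fixed {E : Type*} [NormedAddCommGroup E] [NormedSpace ℝ E] [CompleteSpace E]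
    (Φ : E → E) (hΦ : ContDiff ℝ 1 Φ) : ∃ ε : ℝ, 0 < ε ∧ ∃ u : E, u = ε • Φ u := by
  let Ψ : ℝ × E → ℝ × E := fun x => (x.1, x.2 - x.1 • Φ x.2)
  have hΨ : ContDiff ℝ 1 Ψ := by
    fun_prop
  have hs : HasStrictFDerivAt Ψ (fderiv ℝ Ψ (0, 0)) (0, 0) :=
    hΨ.contDiffAt.hasStrictFDerivAt (by norm_num)
  have hd : HasFDerivAt Ψ ((ContinuousLinearMap.fst ℝ ℝ E).prod
      (ContinuousLinearMap.snd ℝ ℝ E - (ContinuousLinearMap.fst ℝ ℝ E).smulRight (Φ 0)))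
      (0, 0) := by
    have hd1 : HasFDerivAt (fun x : ℝ × E => Φ x.2)
        ((fderiv ℝ Φ 0).comp (ContinuousLinearMap.snd ℝ ℝ E)) (0, 0) :=
      HasFDerivAt.comp (g := Φ) (0, 0) ((hΦ.differentiable (by norm_num)) 0).hasFDerivAt
        hasFDerivAt_snd
    have hd2 := (hasFDerivAt_fst (𝕜 := ℝ) (E := ℝ) (F := E) (p := (0, 0))).smul hd1
    have hd3 := (hasFDerivAt_fst (𝕜 := ℝ) (E := ℝ) (F := E) (p := (0, 0))).prodMk
      ((hasFDerivAt_snd (𝕜 := ℝ) (E := ℝ) (F := E) (p := (0, 0))).sub hd2)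
    refine hd3.congr_fderiv ?_
    simp
  rw [hd.fderiv] at hs
  have hm := hs.map_nhds_eq_of_surj (by
    rw [LinearMap.range_eq_top]
    rintro ⟨x, y⟩
    exact ⟨(x, y + x • Φ 0), by simp⟩)
  have h0 : Ψ (0, 0) = (0, 0) := by simp [Ψ]
  rw [h0] at hm
  have hr : Set.range Ψ ∈ 𝓝 ((0, 0) : ℝ × E) := by
    rw [← hm]
    exact Filter.mem_map.2 (by simp)
  have hc : Filter.Tendsto (fun s : ℝ => ((s, 0) : ℝ × E)) (𝓝[>] 0) (𝓝 (0, 0)) := by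
    have : Continuous (fun s : ℝ => ((s, 0) : ℝ × E)) := by fun_prop
    exact (this.tendsto 0).mono_left nhdsWithin_le_nhds
  obtain ⟨ε, ⟨⟨x, u⟩, hx⟩, hε⟩ := ((hc.eventually_mem hr).and
    self_mem_nhdsWithin).exists
  refine ⟨ε, hε, u, ?_⟩
  simp only [Ψ, Prod.mk.injEq] at hx
  obtain ⟨rfl, hx⟩ := hx
  exact sub_eq_zero.1 hx

/-- multi-index of a word -/
def wrd {ι : Type} [DecidableEq ι] {N n : ℕ} (c : Fin N → ι) (w : Fin n → Fin N) : ι → ℕ :=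
  ∑ i, Pi.single (c (w i)) 1

lemma exists_elem {ι : Type} [Fintype ι] [DecidableEq ι] {N : ℕ} (c : Fin N → ι)
    (g : (Fin N → ℝ) → ℝ) (y0 : Fin N → ℝ) (hg : AnalyticAt ℝ g y0) :
    ∀ᶠ r in 𝓝[>] (0 : ℝ), ∃ F : L1 (ℕ × (ι → ℕ)), ∃ δ > 0,
      ∀ ℓ : L1 (ℕ × (ι → ℕ)) →L[ℝ] ℝ, ∀ z : Fin N → ℝ, ‖z‖ < δ →
        (∀ n (w : Fin n → Fin N), ℓ (bs (0, wrd c w)) = ∏ i, (z (w i) / r)) →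
        ℓ F = g (y0 + z) := by
  obtain ⟨p, R, hp⟩ := hg
  obtain ⟨a, ha0, haR⟩ := ENNReal.lt_iff_exists_nnreal_btwn.1 hp.r_pos
  have ha0' : 0 < (a : ℝ) := by exact_mod_cast ha0
  obtain ⟨C, hC0, hC⟩ := p.norm_mul_pow_le_of_lt_radius (haR.trans_le hp.r_le)
  have hr0 : (0 : ℝ) < a / (2 * (N + 1)) := by positivity
  filter_upwards [Ioo_mem_nhdsGT hr0] with r hr
  obtain ⟨hrpos, hrlt⟩ := hr
  let t : ℕ → L1 (ℕ × (ι → ℕ)) := fun n =>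
    ∑ w : Fin n → Fin N, (p n (fun i => Pi.single (w i) 1) * r ^ n) • bs (0, wrd c w)
  have ht : ∀ n, ‖t n‖ ≤ C * (1 / 2) ^ n := by
    intro n
    have h1 : ‖t n‖ ≤ ∑ w : Fin n → Fin N, ‖p n‖ * r ^ n := by
      refine norm_sum_le_of_le _ fun w _ => ?_
      rw [norm_smul, norm_bs, mul_one, norm_mul, norm_pow, Real.norm_of_nonneg hrpos.le]
      refine mul_le_mul_of_nonneg_right ?_ (by positivity)
      refine ((p n).le_opNorm _).trans (le_of_eq ?_)
      rw [Finset.prod_eq_one, mul_one]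
      intro i _
      rw [Pi.norm_single, norm_one]
    have h2 : ∑ w : Fin n → Fin N, ‖p n‖ * r ^ n = ‖p n‖ * (N * r) ^ n := by
      simp [mul_pow]; ring
    rw [h2] at h1
    refine h1.trans ?_
    have h3 : (N : ℝ) * r ≤ a * (1 / 2) := by
      rw [lt_div_iff₀ (by positivity)] at hrlt
      nlinarith
    calc ‖p n‖ * (N * r) ^ n ≤ ‖p n‖ * (a * (1 / 2)) ^ n := by gcongr
      _ = (‖p n‖ * a ^ n) * (1 / 2) ^ n := by rw [mul_pow]; ring
      _ ≤ C * (1 / 2) ^ n := by gcongr; exact hC n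
  have hts : Summable t := Summable.of_norm_bounded
    ((summable_geometric_of_lt_one (by norm_num) (by norm_num)).mul_left C) ht
  refine ⟨∑' n, t n, a, ha0', fun ℓ z hz hl => ?_⟩
  have hs1 := hts.hasSum.mapL ℓ
  have hs2 := hp.hasSum (y := z) (by
    refine Metric.eball_subset_eball haR.le ?_
    rw [Metric.eball_coe]
    simpa using hz)
  refine hs1.unique ?_
  suffices e : (fun n => ℓ (t n)) = fun n => p n fun _ => z by
    rw [e]; exact hs2
  funext n
  have hz' : z = ∑ A, z A • (Pi.single A 1 : Fin N → ℝ) := by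
    ext B; simp [Finset.sum_apply, Pi.single_apply]
  conv_rhs => rw [hz']
  rw [ContinuousMultilinearMap.map_sum, map_sum]
  refine Finset.sum_congr rfl fun w _ => ?_
  rw [ContinuousMultilinearMap.map_smul_univ, map_smul, hl, smul_eq_mul, smul_eq_mul,
    Finset.prod_div_distrib]
  simp
  field_simp

/-- jet space -/
abbrev Jet (N : ℕ) := (Fin 2 → ℝ) × (Fin N → ℝ) × (Fin N → Fin 2 → ℝ)

/-- indices of the spatial variables `x¹, yᴬ, vᴬ_ρ` -/
abbrev Ix (N : ℕ) := Unit ⊕ (Fin N ⊕ (Fin N × Fin 2))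

/-- the Banach space of unknowns -/
abbrev AA (N : ℕ) := L1 (ℕ × (Ix N → ℕ))

/-- spatial coordinates -/
noncomputable def crd (N : ℕ) : Ix N → Jet N →L[ℝ] ℝ
  | Sum.inl _ => (ContinuousLinearMap.proj 1).comp (ContinuousLinearMap.fst ℝ _ _)
  | Sum.inr (Sum.inl A) => (ContinuousLinearMap.proj A).comp
      ((ContinuousLinearMap.fst ℝ _ _).comp (ContinuousLinearMap.snd ℝ _ _))
  | Sum.inr (Sum.inr (A, ρ)) => ((ContinuousLinearMap.proj ρ).comp
      (ContinuousLinearMap.proj (φ := fun _ : Fin N => Fin 2 → ℝ) A)).comp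
      ((ContinuousLinearMap.snd ℝ _ _).comp (ContinuousLinearMap.snd ℝ _ _))

/-- time coordinate -/
noncomputable def tcrd (N : ℕ) : Jet N →L[ℝ] ℝ :=
  (ContinuousLinearMap.proj 0).comp (ContinuousLinearMap.fst ℝ _ _)

/-- spatial basis vectors -/
noncomputable def cvec (N : ℕ) : Ix N → Jet N
  | Sum.inl _ => (Pi.single 1 1, 0, 0)
  | Sum.inr (Sum.inl A) => (0, Pi.single A 1, 0)
  | Sum.inr (Sum.inr (A, ρ)) => (0, 0, Pi.single A (Pi.single ρ 1))

/-- time basis vector -/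
noncomputable def tvec (N : ℕ) : Jet N := (Pi.single 0 1, 0, 0)

lemma tcrd_tvec (N : ℕ) : tcrd N (tvec N) = 1 := by simp [tcrd, tvec]
lemma tcrd_cvec (N : ℕ) (j : Ix N) : tcrd N (cvec N j) = 0 := by
  rcases j with _ | A | ⟨A, ρ⟩ <;> simp [tcrd, cvec]
lemma crd_tvec (N : ℕ) (j : Ix N) : crd N j (tvec N) = 0 := by
  rcases j with _ | A | ⟨A, ρ⟩ <;> simp [crd, tvec]
lemma crd_cvec_self (N : ℕ) (j : Ix N) : crd N j (cvec N j) = 1 := by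
  rcases j with _ | A | ⟨A, ρ⟩ <;> simp [crd, cvec]
lemma crd_cvec_ne (N : ℕ) (l j : Ix N) (h : l ≠ j) : crd N l (cvec N j) = 0 := by
  rcases j with _ | A | ⟨A, ρ⟩ <;> rcases l with _ | B | ⟨B, σ⟩ <;> simp [crd, cvec] at h ⊢
  · exact Pi.single_eq_of_ne h _
  · by_cases hB : B = A
    · subst hB
      simp [h rfl]
    · simp [hB]

lemma decomp (N : ℕ) (X : Jet N) :
    X = tcrd N X • tvec N + ∑ j, crd N j X • cvec N j := by
  simp only [Fintype.sum_sum_type, Fintype.sum_prod_type]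
  refine Prod.ext ?_ (Prod.ext ?_ ?_)
  · ext i
    fin_cases i <;> simp [tcrd, tvec, crd, cvec, Prod.fst_sum]
  · ext A
    simp [tcrd, tvec, crd, cvec, Prod.fst_sum, Prod.snd_sum, Finset.sum_apply, Pi.single_apply]
  · ext A ρ
    simp only [tcrd, tvec, crd, cvec, Prod.snd_add, Prod.snd_sum, Prod.smul_snd, Finset.sum_apply,
      Pi.add_apply, Pi.smul_apply]
    simp
    rw [Finset.sum_eq_single A]
    · fin_cases ρ <;> simp
    · intro B _ hB
      simp [Pi.single_eq_of_ne hB.symm]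
    · simp

end CKaux
namespace CKaux

section main
variable {N : ℕ}

/-- coefficient families in the Banach space -/
noncomputable def Gel (Fel : Fin N → AA N) (u : (Fin N → AA N) × (Fin N → AA N))
    (A : Fin N) (μ ρ : Fin 2) : AA N :=
  if μ = 0 then (if ρ = 0 then u.1 A else u.2 A)
  else (if ρ = 0 then u.2 A else Fel A - u.1 A)

/-- the coordinate function `vᴬ_μ` as an element of the Banach space -/
noncomputable def vE (p : Jet N) (r : ℝ) (A : Fin N) (μ : Fin 2) : AA N :=
  p.2.2 A μ • bs (0, 0) + r • bs (0, Pi.single (Sum.inr (Sum.inr (A, μ))) 1)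

/-- spatial components of `X_μ` -/
noncomputable def cf (Fel : Fin N → AA N) (p : Jet N) (r : ℝ) (μ : Fin 2)
    (u : (Fin N → AA N) × (Fin N → AA N)) : Ix N → AA N
  | Sum.inl _ => if μ = 0 then 0 else bs (0, 0)
  | Sum.inr (Sum.inl A) => vE p r A μ
  | Sum.inr (Sum.inr (A, ρ)) => Gel Fel u A μ ρ

lemma contDiff_cf (Fel : Fin N → AA N) (p : Jet N) (r : ℝ) (μ : Fin 2) (j : Ix N) :
    ContDiff ℝ 1 (fun u => cf Fel p r μ u j) := by
  rcases j with _ | A | ⟨A, ρ⟩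
  · exact contDiff_const
  · exact contDiff_const
  · simp only [cf, Gel]
    split_ifs <;> fun_prop

/-- the right-hand side -/
noncomputable def Phi (D : Ix N → AA N →L[ℝ] AA N →L[ℝ] AA N) (Fel : Fin N → AA N) (p : Jet N)
    (r : ℝ) (u : (Fin N → AA N) × (Fin N → AA N)) : (Fin N → AA N) × (Fin N → AA N) :=
  (fun B => (∑ A, D (Sum.inr (Sum.inl A)) (vE p r A 0) (Fel B)) +
      (∑ j, D j (cf Fel p r 1 u j) (u.2 B)) - ∑ j, D j (cf Fel p r 0 u j) (u.1 B),
    fun B => (∑ j, D j (cf Fel p r 1 u j) (u.1 B)) - ∑ j, D j (cf Fel p r 0 u j) (u.2 B))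

lemma contDiff_Phi (D : Ix N → AA N →L[ℝ] AA N →L[ℝ] AA N) (Fel : Fin N → AA N) (p : Jet N)
    (r : ℝ) : ContDiff ℝ 1 (Phi D Fel p r) := by
  have h := contDiff_cf Fel p r
  have h1 : ∀ (μ : Fin 2) (j : Ix N) (B : Fin N),
      ContDiff ℝ 1 (fun u => D j (cf Fel p r μ u j) (u.1 B)) := fun μ j B =>
    ((D j).contDiff.comp (h μ j)).clm_apply (by fun_prop)
  have h2 : ∀ (μ : Fin 2) (j : Ix N) (B : Fin N),
      ContDiff ℝ 1 (fun u => D j (cf Fel p r μ u j) (u.2 B)) := fun μ j B =>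
    ((D j).contDiff.comp (h μ j)).clm_apply (by fun_prop)
  unfold Phi
  refine ContDiff.prodMk (contDiff_pi.2 fun B => ?_) (contDiff_pi.2 fun B => ?_)
  · exact (contDiff_const.add (ContDiff.sum fun j _ => h2 1 j B)).sub
      (ContDiff.sum fun j _ => h1 0 j B)
  · exact (ContDiff.sum fun j _ => h1 1 j B).sub (ContDiff.sum fun j _ => h2 0 j B)

lemma mono_wrd {V : Type*} [NormedAddCommGroup V] [NormedSpace ℝ V] {ι : Type} [Fintype ι]
    [DecidableEq ι] (τ : V →L[ℝ] ℝ) (ξ : ι → V →L[ℝ] ℝ) {n : ℕ} (c : Fin N → ι)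
    (w : Fin n → Fin N) (v : V) :
    mono τ ξ (0, wrd c w) v = ∏ i, ξ (c (w i)) v := by
  simp only [mono, wrd, Nat.choose_zero_right, Nat.cast_one, pow_zero, one_mul,
    Finset.sum_apply, Finset.prod_pow_eq_pow_sum]
  simp only [← Finset.prod_pow_eq_pow_sum]
  rw [Finset.prod_comm]
  refine Finset.prod_congr rfl fun i _ => ?_
  rw [Finset.prod_eq_single (c (w i))]
  · simp
  · intro l _ hl
    simp [hl]
  · simp

lemma mono_zero {V : Type*} [NormedAddCommGroup V] [NormedSpace ℝ V] {ι : Type} [Fintype ι]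
    [DecidableEq ι] (τ : V →L[ℝ] ℝ) (ξ : ι → V →L[ℝ] ℝ) (v : V) :
    mono τ ξ (0, 0) v = 1 := by
  simp [mono]

lemma mono_single {V : Type*} [NormedAddCommGroup V] [NormedSpace ℝ V] {ι : Type} [Fintype ι]
    [DecidableEq ι] (τ : V →L[ℝ] ℝ) (ξ : ι → V →L[ℝ] ℝ) (v : V) (j : ι) :
    mono τ ξ (0, Pi.single j 1) v = ξ j v := by
  simp only [mono, Nat.choose_zero_right, Nat.cast_one, pow_zero, one_mul]
  rw [Finset.prod_eq_single j]
  · simp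
  · intro l _ hl
    simp [hl]
  · simp

end main
end CKaux


/-- For the regular quadratic Lagrangian `L = ½ Σ (vᴬ_μ)² + f(y)` with `f` real-analytic,
around every point of the jet space there exist real-analytic coefficients `G^B_{00}`,
`G^B_{01}` satisfying the integrability (vanishing-curvature) conditions of the associated
Euler–Lagrange multivector field `X₀ ∧ X₁`. -/
theorem exists_integrable_eulerLagrange_example (N : ℕ) (hN : 1 ≤ N)
    (f : (Fin N → ℝ) → ℝ) (hf : AnalyticOnNhd ℝ f Set.univ) :
    ∀ p : (Fin 2 → ℝ) × (Fin N → ℝ) × (Fin N → Fin 2 → ℝ),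
      ∃ W : Set ((Fin 2 → ℝ) × (Fin N → ℝ) × (Fin N → Fin 2 → ℝ)),
        IsOpen W ∧ p ∈ W ∧
        ∃ G00 G01 : Fin N → ((Fin 2 → ℝ) × (Fin N → ℝ) × (Fin N → Fin 2 → ℝ)) → ℝ,
          (∀ B : Fin N, AnalyticOnNhd ℝ (G00 B) W ∧ AnalyticOnNhd ℝ (G01 B) W) ∧
          ∀ q ∈ W, ∀ B : Fin N,
            (fderiv ℝ (jetExampleG N f G00 G01 B 1 0) q (jetExampleX N f G00 G01 0 q)
              - fderiv ℝ (jetExampleG N f G00 G01 B 0 0) q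
                  (jetExampleX N f G00 G01 1 q) = 0) ∧
            (fderiv ℝ (jetExampleG N f G00 G01 B 0 0) q (jetExampleX N f G00 G01 0 q)
              - (∑ A : Fin N, q.2.2 A 0 *
                  fderiv ℝ (fun y => fderiv ℝ f y (Pi.single B 1)) q.2.1 (Pi.single A 1))
              - fderiv ℝ (jetExampleG N f G00 G01 B 0 1) q
                  (jetExampleX N f G00 G01 1 q) = 0) := by
  intro p
  have hg : ∀ B : Fin N, AnalyticOnNhd ℝ (fun y => fderiv ℝ f y (Pi.single B 1)) Set.univ :=
    fun B => (ContinuousLinearMap.apply ℝ ℝ (Pi.single B 1 : Fin N → ℝ)).comp_analyticOnNhd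
      hf.fderiv
  have hr := Filter.eventually_all.2 fun B => CKaux.exists_elem
    (fun A : Fin N => (Sum.inr (Sum.inl A) : CKaux.Ix N)) _ p.2.1 (hg B p.2.1 (Set.mem_univ _))
  obtain ⟨r, hr, hr0⟩ := (hr.and self_mem_nhdsWithin).exists
  replace hr0 : 0 < r := hr0
  choose Fel δ hδ hFel using hr
  choose D hD using fun j : CKaux.Ix N => CKaux.exists_D j
  obtain ⟨ε, hε, u, hu⟩ := CKaux.exists_fixed _ (CKaux.contDiff_Phi D Fel p r)
  obtain ⟨R, hR, ev, hev, hm⟩ := CKaux.exists_ev ((ε * r)⁻¹ • CKaux.tcrd N)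
    (fun j => r⁻¹ • CKaux.crd N j)
  have hid : ∀ v ∈ Metric.ball (0 : CKaux.Jet N) R, ∀ (j : CKaux.Ix N) (a b : CKaux.AA N),
      fderiv ℝ ev v (CKaux.tvec N) (ε • D j a b) = ev v a * fderiv ℝ ev v (CKaux.cvec N j) b := by
    intro v hv j a b
    have h := CKaux.D_identity _ _ Metric.isOpen_ball hev.differentiableOn hm j (hD j)
      (et := (ε * r) • CKaux.tvec N) (ej := r • CKaux.cvec N j)
      (by simp [CKaux.tcrd_tvec]; field_simp) (by simp [CKaux.crd_tvec])
      (by simp [CKaux.tcrd_cvec]) (by simp [CKaux.crd_cvec_self]; field_simp)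
      (fun l hl => by simp [CKaux.crd_cvec_ne N l j hl]) hv a b
    simp only [map_smul, _root_.smul_apply, smul_eq_mul] at h ⊢
    have hr0' : r ≠ 0 := hr0.ne'
    refine mul_left_cancel₀ hr0' ?_
    linear_combination h
  obtain ⟨δ₀, hδ₀, hδ₀'⟩ : ∃ δ₀ > 0, ∀ B, δ₀ ≤ δ B := by
    have : Nonempty (Fin N) := ⟨⟨0, hN⟩⟩
    obtain ⟨B, hB⟩ := Finite.exists_min δ
    exact ⟨δ B, hδ B, hB⟩
  have hW : ∀ q ∈ Metric.ball p (min R δ₀), q - p ∈ Metric.ball (0 : CKaux.Jet N) R ∧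
      ‖(q - p).2.1‖ < δ₀ := by
    intro q hq
    rw [mem_ball_iff_norm] at hq
    refine ⟨?_, ?_⟩
    · rw [mem_ball_zero_iff]; exact hq.trans_le (min_le_left _ _)
    · refine lt_of_le_of_lt ?_ (hq.trans_le (min_le_right _ _))
      exact (norm_fst_le (q - p).2).trans (norm_snd_le (q - p))
  have hF : ∀ q ∈ Metric.ball p (min R δ₀), ∀ B,
      ev (q - p) (Fel B) = fderiv ℝ f q.2.1 (Pi.single B 1) := by
    intro q hq B
    have := hFel B (ev (q - p)) (q - p).2.1 ((hW q hq).2.trans_le (hδ₀' B)) (fun n w => by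
      rw [hm _ (hW q hq).1, CKaux.mono_wrd]
      refine Finset.prod_congr rfl fun i _ => ?_
      simp [CKaux.crd]
      field_simp)
    rw [this]
    simp
  have hdev : ∀ q ∈ Metric.ball p (min R δ₀), ∀ a : CKaux.AA N,
      AnalyticAt ℝ (fun q => ev (q - p) a) q ∧
      HasFDerivAt (fun q => ev (q - p) a)
        ((ContinuousLinearMap.apply ℝ ℝ a).comp (fderiv ℝ ev (q - p))) q := by
    intro q hq a
    have ha := hev (q - p) (hW q hq).1
    constructor
    · have hs : AnalyticAt ℝ (fun q : CKaux.Jet N => q - p) q := analyticAt_id.sub analyticAt_const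
      have h1 : AnalyticAt ℝ (fun q => ev (q - p)) q :=
        AnalyticAt.comp' (f := fun q : CKaux.Jet N => q - p) ha hs
      exact AnalyticAt.comp' (f := fun q => ev (q - p))
        ((ContinuousLinearMap.apply ℝ ℝ a).analyticAt _) h1
    · have hs : HasFDerivAt (fun q : CKaux.Jet N => q - p) (ContinuousLinearMap.id ℝ _) q :=
        (hasFDerivAt_id q).sub_const p
      have h2 := HasFDerivAt.comp (f := fun q : CKaux.Jet N => q - p) q
        ha.differentiableAt.hasFDerivAt hs
      exact (ContinuousLinearMap.apply ℝ ℝ a).hasFDerivAt.comp q h2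
  refine ⟨Metric.ball p (min R δ₀), Metric.isOpen_ball,
    Metric.mem_ball_self (lt_min hR hδ₀), fun B q => ev (q - p) (u.1 B),
    fun B q => ev (q - p) (u.2 B),
    fun B => ⟨fun q hq => (hdev q hq _).1, fun q hq => (hdev q hq _).1⟩, ?_⟩
  intro q hq B
  set G00 : Fin N → CKaux.Jet N → ℝ := fun B q => ev (q - p) (u.1 B) with hG00
  set G01 : Fin N → CKaux.Jet N → ℝ := fun B q => ev (q - p) (u.2 B) with hG01
  have hvq := (hW q hq).1
  have hvE : ∀ A μ, ev (q - p) (CKaux.vE p r A μ) = q.2.2 A μ := by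
    intro A μ
    rw [CKaux.vE, map_add, map_smul, map_smul, hm _ hvq, hm _ hvq, CKaux.mono_zero,
      CKaux.mono_single]
    simp [CKaux.crd]
    field_simp
    ring
  have hcf : ∀ μ j, ev (q - p) (CKaux.cf Fel p r μ u j) =
      CKaux.crd N j (jetExampleX N f G00 G01 μ q) := by
    intro μ j
    rcases j with _ | A | ⟨A, ρ⟩
    · fin_cases μ
      · simp [CKaux.cf, CKaux.crd, jetExampleX]
      · simp [CKaux.cf, CKaux.crd, jetExampleX, hm _ hvq, CKaux.mono_zero]
    · simp [CKaux.cf, CKaux.crd, jetExampleX, hvE]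
    · fin_cases μ <;> fin_cases ρ <;>
        simp [CKaux.cf, CKaux.crd, jetExampleX, jetExampleG, CKaux.Gel, hF q hq, hG00, hG01]
  have hX : ∀ μ (a : CKaux.AA N),
      fderiv ℝ (fun q => ev (q - p) a) q (jetExampleX N f G00 G01 μ q) =
      (if μ = 0 then fderiv ℝ ev (q - p) (CKaux.tvec N) a else 0) +
      ∑ j, ev (q - p) (CKaux.cf Fel p r μ u j) * fderiv ℝ ev (q - p) (CKaux.cvec N j) a := by
    intro μ a
    rw [(hdev q hq a).2.fderiv]
    change fderiv ℝ ev (q - p) (jetExampleX N f G00 G01 μ q) a = _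
    conv_lhs => rw [CKaux.decomp N (jetExampleX N f G00 G01 μ q)]
    have ht : CKaux.tcrd N (jetExampleX N f G00 G01 μ q) = if μ = 0 then 1 else 0 := by
      fin_cases μ <;> simp [CKaux.tcrd, jetExampleX]
    rw [ht, map_add, map_sum, _root_.add_apply, _root_.sum_apply]
    simp only [map_smul, _root_.smul_apply, smul_eq_mul, hcf]
    split_ifs <;> simp
  have hsrc : ∀ A, fderiv ℝ (fun y => fderiv ℝ f y (Pi.single B 1)) q.2.1 (Pi.single A 1) =
      fderiv ℝ ev (q - p) (CKaux.cvec N (Sum.inr (Sum.inl A))) (Fel B) := by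
    intro A
    have h1 := (hdev q hq (Fel B)).2
    have h2 : HasFDerivAt (fun q : CKaux.Jet N => fderiv ℝ f q.2.1 (Pi.single B 1))
        ((fderiv ℝ (fun y => fderiv ℝ f y (Pi.single B 1)) q.2.1).comp
          ((ContinuousLinearMap.fst ℝ _ _).comp (ContinuousLinearMap.snd ℝ _ _))) q :=
      HasFDerivAt.comp (g := fun y => fderiv ℝ f y (Pi.single B 1))
        (f := fun q : CKaux.Jet N => q.2.1) q
        (hg B q.2.1 (Set.mem_univ _)).differentiableAt.hasFDerivAt
        (hasFDerivAt_fst.comp q hasFDerivAt_snd)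
    have h3 : (fun q => ev (q - p) (Fel B)) =ᶠ[nhds q]
        (fun q : CKaux.Jet N => fderiv ℝ f q.2.1 (Pi.single B 1)) := by
      filter_upwards [Metric.isOpen_ball.mem_nhds hq] with q' hq'
      exact hF q' hq' B
    have h4 := (h2.congr_of_eventuallyEq h3).unique h1
    exact DFunLike.congr_fun h4 (CKaux.cvec N (Sum.inr (Sum.inl A)))
  have hu1 : fderiv ℝ ev (q - p) (CKaux.tvec N) (u.1 B) =
      (∑ A, q.2.2 A 0 * fderiv ℝ ev (q - p) (CKaux.cvec N (Sum.inr (Sum.inl A))) (Fel B)) +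
      (∑ j, ev (q - p) (CKaux.cf Fel p r 1 u j) *
        fderiv ℝ ev (q - p) (CKaux.cvec N j) (u.2 B)) -
      ∑ j, ev (q - p) (CKaux.cf Fel p r 0 u j) *
        fderiv ℝ ev (q - p) (CKaux.cvec N j) (u.1 B) := by
    have h := congrFun (congrArg Prod.fst hu) B
    conv_lhs => rw [h]
    simp only [CKaux.Phi, Prod.smul_fst, Pi.smul_apply, smul_sub, smul_add, Finset.smul_sum,
      map_sub, map_add, map_sum, hid _ hvq, hvE]
  have hu2 : fderiv ℝ ev (q - p) (CKaux.tvec N) (u.2 B) =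
      (∑ j, ev (q - p) (CKaux.cf Fel p r 1 u j) *
        fderiv ℝ ev (q - p) (CKaux.cvec N j) (u.1 B)) -
      ∑ j, ev (q - p) (CKaux.cf Fel p r 0 u j) *
        fderiv ℝ ev (q - p) (CKaux.cvec N j) (u.2 B) := by
    have h := congrFun (congrArg Prod.snd hu) B
    conv_lhs => rw [h]
    simp only [CKaux.Phi, Prod.smul_snd, Pi.smul_apply, smul_sub, Finset.smul_sum,
      map_sub, map_sum, hid _ hvq]
  have hJ10 : jetExampleG N f G00 G01 B 1 0 = fun q => ev (q - p) (u.2 B) := by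
    simp [jetExampleG, hG01]
  have hJ00 : jetExampleG N f G00 G01 B 0 0 = fun q => ev (q - p) (u.1 B) := by
    simp [jetExampleG, hG00]
  have hJ01 : jetExampleG N f G00 G01 B 0 1 = fun q => ev (q - p) (u.2 B) := by
    simp [jetExampleG, hG01]
  rw [hJ10, hJ00, hJ01, hX, hX, hX, hX]
  simp only [hsrc]
  constructor
  · simp only [if_true, one_ne_zero, if_false]
    linarith
  · simp only [if_true, one_ne_zero, if_false]
    linarith
end
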